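/- Let T be a complete first-order theory such that, for all k ≥ 2, T does not have k-DCTP₂. Then for formulas, Kim-forking over M coincides with Kim-dividing over M: a formula Kim-forks over M if and only if it Kim-divides over M. -/

import Mathlib

/- Common model-theoretic infrastructure for formalizing
   "NSOP₂ theories are NSOP₁" (arXiv:2206.08512).

   We work with a monster model `𝕄` of a complete theory: a sufficiently
   saturated and strongly homogeneous `L`-structure.  Tuples are functions
   `α → 𝕄`; sets of formulas with parameters are coded via `FmlP`. -/

open FirstOrder Language

universe u v w

namespace NSOP2Paper

/-- A first-order formula in free variables `α ⊕ Fin n` together with an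
`n`-tuple of parameters from `𝕄`. -/
abbrev FmlP (L : FirstOrder.Language.{u, u}) (𝕄 : Type u) (α : Type v) :=
  Σ n : ℕ, L.Formula (α ⊕ Fin n) × (Fin n → 𝕄)

/-- `a ≡_C b` : the tuples `a` and `b` satisfy the same formulas with
parameters from `C`. -/
def EqTpOver (L : FirstOrder.Language.{u, u}) {𝕄 : Type u} [L.Structure 𝕄] (C : Set 𝕄)
    {α : Type v} (a b : α → 𝕄) : Prop :=
  ∀ (n : ℕ) (φ : L.Formula (α ⊕ Fin n)) (c : Fin n → 𝕄), (∀ i, c i ∈ C) →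
    (φ.Realize (Sum.elim a c) ↔ φ.Realize (Sum.elim b c))

/-- `tp(a / C)` is finitely satisfiable in `Ms`: every formula over `C`
satisfied by `a` has a realization by a tuple from `Ms`. -/
def FinSatIn (L : FirstOrder.Language.{u, u}) {𝕄 : Type u} [L.Structure 𝕄] (Ms : Set 𝕄)
    {α : Type v} (a : α → 𝕄) (C : Set 𝕄) : Prop :=
  ∀ (n : ℕ) (φ : L.Formula (α ⊕ Fin n)) (c : Fin n → 𝕄), (∀ i, c i ∈ C) →
    φ.Realize (Sum.elim a c) →
    ∃ m : α → 𝕄, (∀ i, m i ∈ Ms) ∧ φ.Realize (Sum.elim m c)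

/-- `Ms` is the underlying set of a (small) elementary submodel of `𝕄`. -/
def IsElemSubmodel (L : FirstOrder.Language.{u, u}) {𝕄 : Type u} [L.Structure 𝕄] (Ms : Set 𝕄) : Prop :=
  ∃ S : L.ElementarySubstructure 𝕄, (S : Set 𝕄) = Ms

/-- A complete consistent global type (a complete type over the monster `𝕄`)
in variables `α`, coded as the set of formulas-with-parameters it contains. -/
structure GlobalType (L : FirstOrder.Language.{u, u}) (𝕄 : Type u) [L.Structure 𝕄] (α : Type v) where
  carrier : Set (FmlP L 𝕄 α)
  consistent : ∀ t : Finset (FmlP L 𝕄 α), ↑t ⊆ carrier →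
    ∃ a : α → 𝕄, ∀ p ∈ t, p.2.1.Realize (Sum.elim a p.2.2)
  complete : ∀ (n : ℕ) (φ : L.Formula (α ⊕ Fin n)) (c : Fin n → 𝕄),
    (⟨n, (φ, c)⟩ : FmlP L 𝕄 α) ∈ carrier ∨ (⟨n, (φ.not, c)⟩ : FmlP L 𝕄 α) ∈ carrier

variable {L : FirstOrder.Language.{u, u}} {𝕄 : Type u} [L.Structure 𝕄]

/-- The global type `q` is finitely satisfiable in `Ms` (i.e. it is a coheir of
its restriction to `Ms`). -/
def GlobalType.FinSatInM {α : Type v} (q : GlobalType L 𝕄 α) (Ms : Set 𝕄) : Prop :=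
  ∀ t : Finset (FmlP L 𝕄 α), ↑t ⊆ q.carrier →
    ∃ m : α → 𝕄, (∀ i, m i ∈ Ms) ∧ ∀ p ∈ t, p.2.1.Realize (Sum.elim m p.2.2)

/-- `a ⊨ q|_C` : the tuple `a` realizes the restriction of the global type `q`
to parameters from `C`. -/
def RealizesType {α : Type v} (q : GlobalType L 𝕄 α) (a : α → 𝕄) (C : Set 𝕄) : Prop :=
  ∀ (n : ℕ) (φ : L.Formula (α ⊕ Fin n)) (c : Fin n → 𝕄), (∀ i, c i ∈ C) →
    (⟨n, (φ, c)⟩ : FmlP L 𝕄 α) ∈ q.carrier → φ.Realize (Sum.elim a c)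

/-- The global type `q` extends `tp(a / C)`. -/
def ExtendsTpOver {α : Type v} (q : GlobalType L 𝕄 α) (C : Set 𝕄) (a : α → 𝕄) : Prop :=
  ∀ (n : ℕ) (φ : L.Formula (α ⊕ Fin n)) (c : Fin n → 𝕄), (∀ i, c i ∈ C) →
    φ.Realize (Sum.elim a c) → (⟨n, (φ, c)⟩ : FmlP L 𝕄 α) ∈ q.carrier

/-- `B` is a coheir Morley sequence over `Ms` in the global type `q`:
`q` is finitely satisfiable in `Ms` and `B i ⊨ q|_(Ms ∪ B_{<i})`. -/
def MorleyIn {α : Type v} (q : GlobalType L 𝕄 α) (Ms : Set 𝕄) (B : ℕ → α → 𝕄) : Prop :=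
  q.FinSatInM Ms ∧
    ∀ i : ℕ, RealizesType q (B i) (Ms ∪ ⋃ (j : ℕ) (_ : j < i), Set.range (B j))

/-- `B` is a coheir Morley sequence over `Ms`. -/
def CoheirMorley (L : FirstOrder.Language.{u, u}) {𝕄 : Type u} [L.Structure 𝕄] (Ms : Set 𝕄)
    {α : Type v} (B : ℕ → α → 𝕄) : Prop :=
  ∃ q : GlobalType L 𝕄 α, MorleyIn q Ms B

/-- Flatten an `ℕ`-indexed sequence of `α`-tuples into a single tuple. -/
def flatSeq {α : Type v} (I : ℕ → α → 𝕄) : ℕ × α → 𝕄 := fun p => I p.1 p.2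

/-- The sequence `I` is indiscernible over `C`. -/
def IndiscernibleOver (L : FirstOrder.Language.{u, u}) {𝕄 : Type u} [L.Structure 𝕄] (C : Set 𝕄)
    {α : Type v} (I : ℕ → α → 𝕄) : Prop :=
  ∀ (n : ℕ) (f g : Fin n → ℕ), StrictMono f → StrictMono g →
    EqTpOver L C (fun p : Fin n × α => I (f p.1) p.2) (fun p : Fin n × α => I (g p.1) p.2)

/-- `𝕄` is `κ`-saturated: every finitely satisfiable set of formulas in fewer
than `κ` variables over a parameter set of size `< κ` is realized in `𝕄`. -/
def IsSaturated (L : FirstOrder.Language.{u, u}) (𝕄 : Type u) [L.Structure 𝕄] (κ : Cardinal.{u}) : Prop :=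
  ∀ (α : Type u) (A : Set 𝕄), Cardinal.mk α < κ → Cardinal.mk A < κ →
    ∀ Γ : Set (FmlP L 𝕄 α), (∀ p ∈ Γ, ∀ i, p.2.2 i ∈ A) →
      (∀ t : Finset (FmlP L 𝕄 α), ↑t ⊆ Γ →
        ∃ a : α → 𝕄, ∀ p ∈ t, p.2.1.Realize (Sum.elim a p.2.2)) →
      ∃ a : α → 𝕄, ∀ p ∈ Γ, p.2.1.Realize (Sum.elim a p.2.2)

/-- `𝕄` is strongly `κ`-homogeneous: partial elementary maps between tuples of
length `< κ` extend to automorphisms of `𝕄`. -/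
def IsStronglyHomogeneous (L : FirstOrder.Language.{u, u}) (𝕄 : Type u) [L.Structure 𝕄]
    (κ : Cardinal.{u}) : Prop :=
  ∀ (α : Type u), Cardinal.mk α < κ → ∀ a b : α → 𝕄, EqTpOver L (∅ : Set 𝕄) a b →
    ∃ σ : 𝕄 ≃[L] 𝕄, ∀ i, σ (a i) = b i

/-- `𝕄` is a monster model (for smallness degree `κ`): sufficiently saturated
and strongly homogeneous. -/
def IsMonster (L : FirstOrder.Language.{u, u}) (𝕄 : Type u) [L.Structure 𝕄] (κ : Cardinal.{u}) : Prop :=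
  Cardinal.aleph0 < κ ∧ IsSaturated L 𝕄 κ ∧ IsStronglyHomogeneous L 𝕄 κ

/-! ### Tree combinatorics -/

/-- The meet (longest common prefix) of two finite sequences. -/
def meet {A : Type w} [DecidableEq A] : List A → List A → List A
  | a :: as, b :: bs => if a = b then a :: meet as bs else []
  | _, _ => []

/-- The meet of `η 0, …, η i`. -/
def combMeet {A : Type w} [DecidableEq A] {k : ℕ} (η : Fin k → List A) (i : Fin k) : List A :=
  (List.ofFn fun j : Fin i.val => η (Fin.castLE i.2.le j)).foldl meet (η i)

/-- `η 0, …, η (k-1)` is a descending comb: a lexicographically increasing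
antichain such that the meet of `η 0, …, η (i+1)` is a proper initial segment
of the meet of `η 0, …, η i`. -/
def DescendingComb {A : Type w} [DecidableEq A] [LT A] {k : ℕ} (η : Fin k → List A) : Prop :=
  (∀ i j : Fin k, i ≠ j → ¬ η i <+: η j) ∧
  (∀ i j : Fin k, i < j → List.Lex (· < ·) (η i) (η j)) ∧
  (∀ (i : ℕ) (h : i + 1 < k),
    combMeet η ⟨i + 1, h⟩ <+: combMeet η ⟨i, by omega⟩ ∧
    combMeet η ⟨i + 1, h⟩ ≠ combMeet η ⟨i, by omega⟩)

/-! ### Tree properties of theories (witnessed in the monster model) -/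

/-- `T = Th(𝕄)` has `SOP₁`. -/
def HasSOP1 (L : FirstOrder.Language.{u, u}) (𝕄 : Type u) [L.Structure 𝕄] : Prop :=
  ∃ (k m : ℕ) (φ : L.Formula (Fin k ⊕ Fin m)) (b : List Bool → Fin m → 𝕄),
    (∀ σ : ℕ → Bool, ∃ a : Fin k → 𝕄,
      ∀ n : ℕ, φ.Realize (Sum.elim a (b (List.ofFn fun i : Fin n => σ i)))) ∧
    ∀ η₁ η₂ : List Bool, (η₁ ++ [false]) <+: η₂ →
      ¬ ∃ a : Fin k → 𝕄, φ.Realize (Sum.elim a (b η₂)) ∧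
        φ.Realize (Sum.elim a (b (η₁ ++ [true])))

/-- `T = Th(𝕄)` has `SOP₂`. -/
def HasSOP2 (L : FirstOrder.Language.{u, u}) (𝕄 : Type u) [L.Structure 𝕄] : Prop :=
  ∃ (k m : ℕ) (φ : L.Formula (Fin k ⊕ Fin m)) (b : List Bool → Fin m → 𝕄),
    (∀ σ : ℕ → Bool, ∃ a : Fin k → 𝕄,
      ∀ n : ℕ, φ.Realize (Sum.elim a (b (List.ofFn fun i : Fin n => σ i)))) ∧
    ∀ η₁ η₂ : List Bool, ¬ η₁ <+: η₂ → ¬ η₂ <+: η₁ →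
      ¬ ∃ a : Fin k → 𝕄, φ.Realize (Sum.elim a (b η₁)) ∧ φ.Realize (Sum.elim a (b η₂))

/-- `T = Th(𝕄)` has `k`-`DCTP₁`: paths are consistent but descending combs of
size `k` are inconsistent. -/
def HasKDCTP1 (L : FirstOrder.Language.{u, u}) (𝕄 : Type u) [L.Structure 𝕄] (k : ℕ) : Prop :=
  ∃ (r m : ℕ) (φ : L.Formula (Fin r ⊕ Fin m)) (b : List ℕ → Fin m → 𝕄),
    (∀ σ : ℕ → ℕ, ∃ a : Fin r → 𝕄,
      ∀ n : ℕ, φ.Realize (Sum.elim a (b (List.ofFn fun i : Fin n => σ i)))) ∧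
    ∀ η : Fin k → List ℕ, DescendingComb η →
      ¬ ∃ a : Fin r → 𝕄, ∀ i, φ.Realize (Sum.elim a (b (η i)))

/-- `T = Th(𝕄)` has weak `k`-`TP₁`: paths are consistent but any `k` pairwise
incomparable nodes with common pairwise meet are inconsistent. -/
def HasWeakKTP1 (L : FirstOrder.Language.{u, u}) (𝕄 : Type u) [L.Structure 𝕄] (k : ℕ) : Prop :=
  ∃ (r m : ℕ) (φ : L.Formula (Fin r ⊕ Fin m)) (b : List ℕ → Fin m → 𝕄),
    (∀ σ : ℕ → ℕ, ∃ a : Fin r → 𝕄,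
      ∀ n : ℕ, φ.Realize (Sum.elim a (b (List.ofFn fun i : Fin n => σ i)))) ∧
    ∀ η : Fin k → List ℕ,
      (∀ i j, i ≠ j → ¬ η i <+: η j) →
      (∀ i j i' j' : Fin k, i ≠ j → i' ≠ j' → meet (η i) (η j) = meet (η i') (η j')) →
      ¬ ∃ a : Fin r → 𝕄, ∀ i, φ.Realize (Sum.elim a (b (η i)))

/-- `T = Th(𝕄)` has `k`-`DCTP₂`: paths are `k`-inconsistent but descending
combs are consistent. -/
def HasKDCTP2 (L : FirstOrder.Language.{u, u}) (𝕄 : Type u) [L.Structure 𝕄] (k : ℕ) : Prop :=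
  ∃ (r m : ℕ) (φ : L.Formula (Fin r ⊕ Fin m)) (b : List Bool → Fin m → 𝕄),
    (∀ σ : ℕ → Bool, ∀ s : Finset ℕ, s.card = k →
      ¬ ∃ a : Fin r → 𝕄, ∀ n ∈ s,
        φ.Realize (Sum.elim a (b (List.ofFn fun i : Fin n => σ i)))) ∧
    ∀ (l : ℕ) (η : Fin l → List Bool), DescendingComb η →
      ∃ a : Fin r → 𝕄, ∀ i, φ.Realize (Sum.elim a (b (η i)))

/-! ### Kim-dividing and Conant-dividing, with respect to coheir Morley sequences -/

/-- `φ(x, b)` Kim-divides over `Ms`: some coheir Morley sequence over `Ms`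
starting with `b` makes it inconsistent. -/
def KimDivides (L : FirstOrder.Language.{u, u}) {𝕄 : Type u} [L.Structure 𝕄] (Ms : Set 𝕄)
    {α : Type v} {n : ℕ} (φ : L.Formula (α ⊕ Fin n)) (b : Fin n → 𝕄) : Prop :=
  ∃ B : ℕ → Fin n → 𝕄, CoheirMorley L Ms B ∧ B 0 = b ∧
    ¬ ∃ a : α → 𝕄, ∀ i, φ.Realize (Sum.elim a (B i))

/-- `φ(x, b)` Kim-forks over `Ms`: it implies a finite disjunction of formulas
Kim-dividing over `Ms`. -/
def KimForks (L : FirstOrder.Language.{u, u}) {𝕄 : Type u} [L.Structure 𝕄] (Ms : Set 𝕄)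
    {α : Type v} {n : ℕ} (φ : L.Formula (α ⊕ Fin n)) (b : Fin n → 𝕄) : Prop :=
  ∃ (N : ℕ) (m : Fin N → ℕ) (ψ : ∀ j : Fin N, L.Formula (α ⊕ Fin (m j)))
    (c : ∀ j : Fin N, Fin (m j) → 𝕄),
    (∀ j, KimDivides L Ms (ψ j) (c j)) ∧
    ∀ a : α → 𝕄, φ.Realize (Sum.elim a b) → ∃ j, (ψ j).Realize (Sum.elim a (c j))

/-- `φ(x, b)` Conant-divides over `Ms`: every coheir Morley sequence over `Ms`
starting with `b` makes it inconsistent. -/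
def ConantDivides (L : FirstOrder.Language.{u, u}) {𝕄 : Type u} [L.Structure 𝕄] (Ms : Set 𝕄)
    {α : Type v} {n : ℕ} (φ : L.Formula (α ⊕ Fin n)) (b : Fin n → 𝕄) : Prop :=
  ∀ B : ℕ → Fin n → 𝕄, CoheirMorley L Ms B → B 0 = b →
    ¬ ∃ a : α → 𝕄, ∀ i, φ.Realize (Sum.elim a (B i))

/-- `φ(x, b)` Conant-forks over `Ms`. -/
def ConantForks (L : FirstOrder.Language.{u, u}) {𝕄 : Type u} [L.Structure 𝕄] (Ms : Set 𝕄)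
    {α : Type v} {n : ℕ} (φ : L.Formula (α ⊕ Fin n)) (b : Fin n → 𝕄) : Prop :=
  ∃ (N : ℕ) (m : Fin N → ℕ) (ψ : ∀ j : Fin N, L.Formula (α ⊕ Fin (m j)))
    (c : ∀ j : Fin N, Fin (m j) → 𝕄),
    (∀ j, ConantDivides L Ms (ψ j) (c j)) ∧
    ∀ a : α → 𝕄, φ.Realize (Sum.elim a b) → ∃ j, (ψ j).Realize (Sum.elim a (c j))

/-- `a ⫝^{K*}_{Ms} b` : `tp(a/Ms b)` contains no formula Conant-forking
over `Ms`. -/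
def ConantIndep (L : FirstOrder.Language.{u, u}) {𝕄 : Type u} [L.Structure 𝕄] (Ms : Set 𝕄)
    {α : Type v} {β : Type w} (a : α → 𝕄) (b : β → 𝕄) : Prop :=
  ∀ (n : ℕ) (φ : L.Formula (α ⊕ Fin n)) (d : Fin n → 𝕄),
    (∀ i, d i ∈ Ms ∪ Set.range b) → φ.Realize (Sum.elim a d) →
    ¬ ConantForks L Ms φ d

/-! ### Abstract independence relations between sets over models -/

/-- An abstract ternary relation `A ⫝_M B` between subsets of `𝕄` over
(elementary submodels of) `𝕄`. -/
structure IndRel (L : FirstOrder.Language.{u, u}) (𝕄 : Type u) [L.Structure 𝕄] where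
  rel : Set 𝕄 → Set 𝕄 → Set 𝕄 → Prop

/-- A set `S` of `α`-tuples is type-definable over `C`. -/
def TypeDefinableOver (L : FirstOrder.Language.{u, u}) {𝕄 : Type u} [L.Structure 𝕄] (C : Set 𝕄)
    {γ : Type v} (S : Set (γ → 𝕄)) : Prop :=
  ∃ Γ : Set (FmlP L 𝕄 γ), (∀ p ∈ Γ, ∀ i, p.2.2 i ∈ C) ∧
    ∀ g : γ → 𝕄, g ∈ S ↔ ∀ p ∈ Γ, p.2.1.Realize (Sum.elim g p.2.2)

namespace IndRel


/-- Invariance under automorphisms of `𝕄`. -/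
def Invariant (R : IndRel L 𝕄) : Prop :=
  ∀ (σ : 𝕄 ≃[L] 𝕄) (A Ms B : Set 𝕄), R.rel A Ms B →
    R.rel ((⇑σ) '' A) ((⇑σ) '' Ms) ((⇑σ) '' B)

/-- Monotonicity (on both sides). -/
def Mono (R : IndRel L 𝕄) : Prop :=
  ∀ (A A' Ms B B' : Set 𝕄), IsElemSubmodel L Ms → R.rel A Ms B →
    Ms ⊆ A' → A' ⊆ A → Ms ⊆ B' → B' ⊆ B → R.rel A' Ms B'

/-- Existence: for `M ⊆ A, B` there is `A' ≡_M A` with `A' ⫝_M B`. -/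
def Existence (R : IndRel L 𝕄) (κ : Cardinal.{u}) : Prop :=
  ∀ (Ms : Set 𝕄), IsElemSubmodel L Ms → Cardinal.mk Ms < κ →
    ∀ (α β : Type u), Cardinal.mk α < κ → Cardinal.mk β < κ →
      ∀ (a : α → 𝕄) (b : β → 𝕄),
        ∃ a' : α → 𝕄, EqTpOver L Ms a' a ∧
          R.rel (Ms ∪ Set.range a') Ms (Ms ∪ Set.range b)

/-- Right extension. -/
def RightExt (R : IndRel L 𝕄) (κ : Cardinal.{u}) : Prop :=
  ∀ (Ms : Set 𝕄), IsElemSubmodel L Ms → Cardinal.mk Ms < κ →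
    ∀ (α : Type u), Cardinal.mk α < κ → ∀ (a : α → 𝕄) (B C : Set 𝕄),
      Cardinal.mk B < κ → Cardinal.mk C < κ →
      R.rel (Set.range a) Ms B → B ⊆ C →
      ∃ a' : α → 𝕄, EqTpOver L B a' a ∧ R.rel (Set.range a') Ms C

/-- Quasi-strong finite character: for complete types `p = tp(a₀/Ms)` and
`q = tp(b₀/Ms)`, the set of pairs of realizations `(a, b)` with `a ⫝_Ms b`
is type-definable over `Ms`. -/
def QSFC (R : IndRel L 𝕄) (κ : Cardinal.{u}) : Prop :=
  ∀ (Ms : Set 𝕄), IsElemSubmodel L Ms → Cardinal.mk Ms < κ →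
    ∀ (α β : Type u), Cardinal.mk α < κ → Cardinal.mk β < κ →
      ∀ (a₀ : α → 𝕄) (b₀ : β → 𝕄),
        TypeDefinableOver L Ms {g : (α ⊕ β) → 𝕄 |
          EqTpOver L Ms (g ∘ Sum.inl) a₀ ∧ EqTpOver L Ms (g ∘ Sum.inr) b₀ ∧
          R.rel (Set.range (g ∘ Sum.inl)) Ms (Set.range (g ∘ Sum.inr))}

/-- The coheir chain condition. -/
def CoheirChain (R : IndRel L 𝕄) (κ : Cardinal.{u}) : Prop :=
  ∀ (Ms : Set 𝕄), IsElemSubmodel L Ms → Cardinal.mk Ms < κ →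
    ∀ (α β : Type u), Cardinal.mk α < κ → Cardinal.mk β < κ →
      ∀ (a : α → 𝕄) (b : β → 𝕄), R.rel (Set.range a) Ms (Set.range b) →
        ∀ I : ℕ → β → 𝕄, CoheirMorley L Ms I → I 0 = b →
          ∃ I' : ℕ → β → 𝕄, EqTpOver L Ms (flatSeq I') (flatSeq I) ∧
            R.rel (Set.range a) Ms (⋃ i, Set.range (I' i)) ∧
            ∀ i, EqTpOver L (Ms ∪ Set.range a) (I' i) b

/-- `R` implies `⫝ʰ` : `A ⫝_M B` implies `tp(B / M A)` is finitely
satisfiable in `M`. -/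
def StrongerThanH (R : IndRel L 𝕄) : Prop :=
  ∀ (A Ms B : Set 𝕄), IsElemSubmodel L Ms → R.rel A Ms B →
    FinSatIn L Ms (fun x : B => (x : 𝕄)) (Ms ∪ A)

end IndRel

/-- The axioms satisfied by the relations among which `⫝^CK` is weakest. -/
def GoodRel (R : IndRel L 𝕄) (κ : Cardinal.{u}) : Prop :=
  R.StrongerThanH ∧ R.Invariant ∧ R.Mono ∧ R.Existence κ ∧ R.RightExt κ ∧ R.CoheirChain κ

/-- `R` is `⫝^CK` : the weakest relation implying `⫝ʰ` and satisfying
invariance, monotonicity, existence, right extension and the coheir chain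
condition. -/
def IsCK (R : IndRel L 𝕄) (κ : Cardinal.{u}) : Prop :=
  GoodRel R κ ∧ ∀ R' : IndRel L 𝕄, GoodRel R' κ →
    ∀ A Ms B : Set 𝕄, R'.rel A Ms B → R.rel A Ms B

/-- `q` is a canonical global type over `Ms` (w.r.t. the relation `R = ⫝^CK`):
whenever `c ⊨ q|_{Ms b}` we have `b ⫝^CK_{Ms} c`. -/
def IsCanonicalGlobal (R : IndRel L 𝕄) (κ : Cardinal.{u}) (Ms : Set 𝕄) {α : Type v}
    (q : GlobalType L 𝕄 α) : Prop :=
  ∀ (β : Type u), Cardinal.mk β < κ → ∀ (b : β → 𝕄) (c : α → 𝕄),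
    RealizesType q c (Ms ∪ Set.range b) → R.rel (Set.range b) Ms (Set.range c)

/-- A canonical Morley sequence over `Ms`: a coheir Morley sequence in a
canonical coheir. -/
def CanonicalMorley (R : IndRel L 𝕄) (κ : Cardinal.{u}) (Ms : Set 𝕄) {α : Type v}
    (I : ℕ → α → 𝕄) : Prop :=
  ∃ q : GlobalType L 𝕄 α, IsCanonicalGlobal R κ Ms q ∧ MorleyIn q Ms I

/-- `q` is a strong canonical global type over `Ms`. -/
def IsStrongCanonical (R : IndRel L 𝕄) (κ : Cardinal.{u}) (Ms : Set 𝕄) {α : Type v}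
    (q : GlobalType L 𝕄 α) : Prop :=
  ∀ (β : Type u), Cardinal.mk β < κ → ∀ (b : β → 𝕄) (c : α → 𝕄),
    RealizesType q c (Ms ∪ Set.range b) →
    ∀ (γ : Type u), Cardinal.mk γ < κ → ∀ (a : γ → 𝕄),
      ∃ a' : γ → 𝕄, EqTpOver L (Ms ∪ Set.range c) a' a ∧
        ∃ q' : GlobalType L 𝕄 (γ ⊕ α), IsCanonicalGlobal R κ Ms q' ∧
          ExtendsTpOver q' (Ms ∪ Set.range b) (Sum.elim a' c)

/-! ### `M`-invariant ideals and `𝓘`-Kim-dividing -/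

/-- An `Ms`-invariant ideal on the definable subsets of `𝕄` (in variables `α`). -/
structure InvIdeal (L : FirstOrder.Language.{u, u}) (𝕄 : Type u) [L.Structure 𝕄] (Ms : Set 𝕄)
    (α : Type v) where
  mem : Set (α → 𝕄) → Prop
  definable_of_mem : ∀ S, mem S → ∃ (n : ℕ) (ψ : L.Formula (α ⊕ Fin n)) (c : Fin n → 𝕄),
    S = {a : α → 𝕄 | ψ.Realize (Sum.elim a c)}
  union_mem : ∀ S T, mem S → mem T → mem (S ∪ T)
  subset_mem : ∀ S T, mem S →
    (∃ (n : ℕ) (ψ : L.Formula (α ⊕ Fin n)) (c : Fin n → 𝕄),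
      T = {a : α → 𝕄 | ψ.Realize (Sum.elim a c)}) →
    T ⊆ S → mem T
  invariant : ∀ σ : 𝕄 ≃[L] 𝕄, (∀ x ∈ Ms, σ x = x) → ∀ S, mem S →
    mem ((fun a => (⇑σ) ∘ a) '' S)

/-- `φ(x, b)` `𝓘`-Kim-divides over `Ms`. -/
def IKimDivides {Ms : Set 𝕄} {α : Type v} (I : InvIdeal L 𝕄 Ms α) {n : ℕ}
    (φ : L.Formula (α ⊕ Fin n)) (b : Fin n → 𝕄) : Prop :=
  ∃ (B : ℕ → Fin n → 𝕄) (k : ℕ), CoheirMorley L Ms B ∧ B 0 = b ∧ 0 < k ∧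
    ∀ s : Finset ℕ, s.card = k →
      I.mem {a : α → 𝕄 | ∀ i ∈ s, φ.Realize (Sum.elim a (B i))}

/-- `φ(x, b)` `𝓘`-Kim-forks over `Ms`. -/
def IKimForks {Ms : Set 𝕄} {α : Type v} (I : InvIdeal L 𝕄 Ms α) {n : ℕ}
    (φ : L.Formula (α ⊕ Fin n)) (b : Fin n → 𝕄) : Prop :=
  ∃ (N : ℕ) (m : Fin N → ℕ) (ψ : ∀ j : Fin N, L.Formula (α ⊕ Fin (m j)))
    (c : ∀ j : Fin N, Fin (m j) → 𝕄),
    (∀ j, IKimDivides I (ψ j) (c j)) ∧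
    ∀ a : α → 𝕄, φ.Realize (Sum.elim a b) → ∃ j, (ψ j).Realize (Sum.elim a (c j))

/-- `φ(x, b)` `𝓘`-quasi-divides over `Ms`. -/
def IQuasiDivides {Ms : Set 𝕄} {α : Type v} (I : InvIdeal L 𝕄 Ms α) {n : ℕ}
    (φ : L.Formula (α ⊕ Fin n)) (b : Fin n → 𝕄) : Prop :=
  ∃ (mm : ℕ) (b' : Fin mm → Fin n → 𝕄), 0 < mm ∧ (∀ j, EqTpOver L Ms (b' j) b) ∧
    I.mem {a : α → 𝕄 | ∀ j, φ.Realize (Sum.elim a (b' j))}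

/-! ### `h^⫝`-inconsistency and the derived relation `⫝'` -/

/-- A family of formulas is `h^⫝`-inconsistent with respect to `P = tp(a₀/Ms)`. -/
def HInconsistent (R : IndRel L 𝕄) (Ms : Set 𝕄) {α : Type v} (a₀ : α → 𝕄)
    {ι : Type w} (m : ι → ℕ) (φ : ∀ i : ι, L.Formula (α ⊕ Fin (m i)))
    (b : ∀ i : ι, Fin (m i) → 𝕄) : Prop :=
  ¬ ∃ a : α → 𝕄, EqTpOver L Ms a a₀ ∧
      R.rel (Set.range a) Ms (⋃ i, Set.range (b i)) ∧
      ∀ i, (φ i).Realize (Sum.elim a (b i))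

/-- A single formula is `h^⫝`-inconsistent with respect to `P = tp(a₀/Ms)`. -/
def HInconsistentSingle (R : IndRel L 𝕄) (Ms : Set 𝕄) {α : Type v} (a₀ : α → 𝕄)
    {n : ℕ} (φ : L.Formula (α ⊕ Fin n)) (b : Fin n → 𝕄) : Prop :=
  ¬ ∃ a : α → 𝕄, EqTpOver L Ms a a₀ ∧ R.rel (Set.range a) Ms (Set.range b) ∧
      φ.Realize (Sum.elim a b)

/-- `φ(x, b)` `h^⫝`-Kim-divides with respect to `tp(a₀/Ms)`. -/
def HKimDivides (R : IndRel L 𝕄) (Ms : Set 𝕄) {α : Type v} (a₀ : α → 𝕄)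
    {n : ℕ} (φ : L.Formula (α ⊕ Fin n)) (b : Fin n → 𝕄) : Prop :=
  ∃ B : ℕ → Fin n → 𝕄, CoheirMorley L Ms B ∧ B 0 = b ∧
    HInconsistent R Ms a₀ (fun _ : ℕ => n) (fun _ => φ) B

/-- `φ(x, b)` `h^⫝`-Kim-forks with respect to `tp(a₀/Ms)`. -/
def HKimForks (R : IndRel L 𝕄) (Ms : Set 𝕄) {α : Type v} (a₀ : α → 𝕄)
    {n : ℕ} (φ : L.Formula (α ⊕ Fin n)) (b : Fin n → 𝕄) : Prop :=
  ∃ (N : ℕ) (m : Fin N → ℕ) (ψ : ∀ j : Fin N, L.Formula (α ⊕ Fin (m j)))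
    (c : ∀ j : Fin N, Fin (m j) → 𝕄),
    (∀ j, HKimDivides R Ms a₀ (ψ j) (c j)) ∧
    ∀ a : α → 𝕄, φ.Realize (Sum.elim a b) → ∃ j, (ψ j).Realize (Sum.elim a (c j))

/-- `φ(x, b)` `h^⫝`-quasi-divides with respect to `tp(a₀/Ms)`. -/
def HQuasiDivides (R : IndRel L 𝕄) (Ms : Set 𝕄) {α : Type v} (a₀ : α → 𝕄)
    {n : ℕ} (φ : L.Formula (α ⊕ Fin n)) (b : Fin n → 𝕄) : Prop :=
  ∃ (mm : ℕ) (b' : Fin mm → Fin n → 𝕄), 0 < mm ∧ (∀ j, EqTpOver L Ms (b' j) b) ∧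
    HInconsistent R Ms a₀ (fun _ : Fin mm => n) (fun _ => φ) b'

/-- The derived relation `⫝'` on tuples:
`tp(a / Ms b)` contains no formula `h^⫝`-Kim-forking w.r.t. `tp(a/Ms)`. -/
def DerivedIndep (R : IndRel L 𝕄) (Ms : Set 𝕄) {α : Type v} {β : Type w}
    (a : α → 𝕄) (b : β → 𝕄) : Prop :=
  ∀ (n : ℕ) (φ : L.Formula (α ⊕ Fin n)) (d : Fin n → 𝕄),
    (∀ i, d i ∈ Ms ∪ Set.range b) → φ.Realize (Sum.elim a d) →
    ¬ HKimForks R Ms a φ d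

/-- The derived relation `⫝'` as a relation between sets over models. -/
def derived (R : IndRel L 𝕄) : IndRel L 𝕄 where
  rel A Ms B := ∀ (n : ℕ) (φ : L.Formula (↥A ⊕ Fin n)) (d : Fin n → 𝕄),
    (∀ i, d i ∈ Ms ∪ B) → φ.Realize (Sum.elim (fun x : A => (x : 𝕄)) d) →
    ¬ HKimForks R Ms (fun x : A => (x : 𝕄)) φ d

/-! ### Coheir trees -/

/-- The tuple, indexed by extensions, consisting of the part of the tree `c`
lying (weakly) above the node `ν` (where `ν` has length `Lh`). -/
def subtreeTupleLen {α : Type v} {n : ℕ} (c : {l : List ℕ // l.length ≤ n} → α → 𝕄)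
    (Lh : ℕ) (ν : List ℕ) (hν : ν.length = Lh) :
    ({s : List ℕ // Lh + s.length ≤ n} × α) → 𝕄 :=
  fun p => c ⟨ν ++ p.1.1, by rw [List.length_append, hν]; exact p.1.2⟩ p.2

end NSOP2Paper

namespace NSOP2Paper

open Set Filter Cardinal

section Basics

variable {L : FirstOrder.Language.{u, u}} {𝕄 : Type u} [L.Structure 𝕄] {α : Type v} {β : Type w}

/-! ### Definable sets and formulas with a finite tuple of parameters -/

theorem definable_setOf_realize {A : Set 𝕄} {n : ℕ} (φ : L.Formula (α ⊕ Fin n)) {c : Fin n → 𝕄}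
    (hc : ∀ i, c i ∈ A) : A.Definable L {v : α → 𝕄 | φ.Realize (Sum.elim v c)} := by
  rw [definable_iff_exists_formula_sum]
  refine ⟨φ.relabel (Sum.elim Sum.inr fun i => Sum.inl ⟨c i, hc i⟩), ?_⟩
  ext v
  simp only [mem_ofPred_eq, Formula.realize_relabel]
  refine iff_of_eq (congrArg _ ?_)
  funext x
  rcases x with x | x <;> rfl

theorem exists_formula_of_definable {A : Set 𝕄} {D : Set (α → 𝕄)} (hD : A.Definable L D) :
    ∃ (n : ℕ) (φ : L.Formula (α ⊕ Fin n)) (c : Fin n → 𝕄), (∀ i, c i ∈ A) ∧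
      ∀ v, v ∈ D ↔ φ.Realize (Sum.elim v c) := by
  obtain ⟨A₀, hA₀, hD⟩ := definable_iff_finitely_definable.1 hD
  obtain ⟨φ, rfl⟩ := definable_iff_exists_formula_sum.1 hD
  obtain ⟨n, ⟨e⟩⟩ := Finite.exists_equiv_fin (A₀ : Set 𝕄)
  refine ⟨n, φ.relabel (Sum.elim (fun x => Sum.inr (e x)) Sum.inl), fun i => (e.symm i : 𝕄),
    fun i => hA₀ (e.symm i).2, fun v => ?_⟩
  simp only [mem_ofPred_eq, Formula.realize_relabel]
  refine iff_of_eq (congrArg _ ?_)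
  funext x
  rcases x with x | x <;> simp

theorem Definable.preimage_equiv {A : Set 𝕄} {D : Set (α → 𝕄)} (σ : 𝕄 ≃[L] 𝕄)
    (hD : (σ '' A).Definable L D) : A.Definable L {v : α → 𝕄 | (fun i => σ (v i)) ∈ D} := by
  obtain ⟨n, φ, c, hc, h⟩ := exists_formula_of_definable hD
  choose c' hc' hcc using hc
  convert definable_setOf_realize (A := A) φ hc' using 1
  ext v
  simp only [mem_ofPred_eq, h]
  rw [← StrongHomClass.realize_formula σ (v := Sum.elim v c')]
  refine iff_of_eq (congrArg _ ?_)
  funext x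
  rcases x with x | x <;> simp [hcc]

theorem IsElemSubmodel.exists_mem [Finite α] {Ms : Set 𝕄} (hMs : IsElemSubmodel L Ms)
    {D : Set (α → 𝕄)} (hD : Ms.Definable L D) (hne : D.Nonempty) :
    ∃ m : α → Ms, (fun i => (m i : 𝕄)) ∈ D := by
  obtain ⟨S, rfl⟩ := hMs
  obtain ⟨φ, rfl⟩ := definable_iff_exists_formula_sum.1 hD
  obtain ⟨v, hv⟩ := hne
  have h1 : (φ.iExs α).Realize (fun x : (S : Set 𝕄) => (x : 𝕄)) :=
    Formula.realize_iExs.2 ⟨v, hv⟩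
  have h2 : (φ.iExs α).Realize (fun x : S => x) :=
    (S.subtype.map_formula (φ.iExs α) (fun x : S => x)).1 h1
  obtain ⟨m, hm⟩ := Formula.realize_iExs.1 h2
  refine ⟨m, ?_⟩
  have h3 := (S.subtype.map_formula φ _).2 hm
  simp only [mem_ofPred_eq]
  convert h3 using 1
  funext x
  rcases x with x | x <;> rfl

/-! ### Saturation and homogeneity in terms of definable sets -/

variable {κ : Cardinal.{u}}

theorem IsMonster.exists_mem_sInter [Countable α] (hm : IsMonster L 𝕄 κ) {A : Set 𝕄}
    (hA : #A < κ) (𝒟 : Set (Set (α → 𝕄))) (hdef : ∀ D ∈ 𝒟, A.Definable L D)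
    (hfip : ∀ t ⊆ 𝒟, t.Finite → (⋂₀ t).Nonempty) : (⋂₀ 𝒟).Nonempty := by
  classical
  let e : α ≃ Shrink.{u} α := equivShrink.{u} α
  have hcard : #(Shrink.{u} α) < κ :=
    lt_of_le_of_lt (mk_le_aleph0_iff.2 e.symm.injective.countable) hm.1
  let S : FmlP L 𝕄 (Shrink.{u} α) → Set (α → 𝕄) :=
    fun p => {v | p.2.1.Realize (Sum.elim (v ∘ e.symm) p.2.2)}
  obtain ⟨a, ha⟩ := hm.2.1 (Shrink.{u} α) A hcard hA
    {p | (∀ i, p.2.2 i ∈ A) ∧ S p ∈ 𝒟} (fun p hp => hp.1) (by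
      intro t ht
      obtain ⟨v, hv⟩ := hfip (S '' t) (by rintro _ ⟨p, hp, rfl⟩; exact (ht hp).2)
        (t.finite_toSet.image S)
      exact ⟨v ∘ e.symm, fun p hp => hv (S p) ⟨p, hp, rfl⟩⟩)
  refine ⟨a ∘ e, fun D hD => ?_⟩
  obtain ⟨n, φ, c, hc, h⟩ := exists_formula_of_definable (hdef D hD)
  let p : FmlP L 𝕄 (Shrink.{u} α) := ⟨n, φ.relabel (Sum.map e id), c⟩
  have hr : ∀ w : Shrink.{u} α → 𝕄, p.2.1.Realize (Sum.elim w p.2.2) ↔ w ∘ e ∈ D := by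
    intro w
    rw [h]
    simp only [p, Formula.realize_relabel]
    refine iff_of_eq (congrArg _ ?_)
    funext x
    rcases x with x | x <;> rfl
  have hS : S p = D := by
    ext v
    refine (hr _).trans ?_
    rw [Function.comp_assoc, Equiv.symm_comp_self, Function.comp_id]
  exact (hr a).1 (ha p ⟨hc, by rw [hS]; exact hD⟩)

theorem IsMonster.exists_equiv [Countable α] (hm : IsMonster L 𝕄 κ) {A : Set 𝕄} (hA : #A < κ)
    {d d' : α → 𝕄} (h : ∀ D : Set (α → 𝕄), A.Definable L D → d ∈ D → d' ∈ D) :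
    ∃ σ : 𝕄 ≃[L] 𝕄, (∀ x ∈ A, σ x = x) ∧ ∀ i, σ (d i) = d' i := by
  let e : α ≃ Shrink.{u} α := equivShrink.{u} α
  have hcard : #(A ⊕ Shrink.{u} α : Type u) < κ := by
    rw [mk_sum, lift_id, lift_id]
    exact add_lt_of_lt hm.1.le hA
      (lt_of_le_of_lt (mk_le_aleph0_iff.2 e.symm.injective.countable) hm.1)
  have h' : ∀ D : Set (α → 𝕄), A.Definable L D → (d ∈ D ↔ d' ∈ D) := fun D hD =>
    ⟨h D hD, fun hd' => by_contra fun hd => h Dᶜ hD.compl hd hd'⟩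
  obtain ⟨σ, hσ⟩ := hm.2.2 (A ⊕ Shrink.{u} α) hcard (Sum.elim (fun x => (x : 𝕄)) (d ∘ e.symm))
    (Sum.elim (fun x => (x : 𝕄)) (d' ∘ e.symm)) (by
      intro n φ c hc
      have hn : n = 0 := by
        by_contra hn
        exact hc ⟨0, Nat.pos_of_ne_zero hn⟩
      subst hn
      let ψ : L.Formula (A ⊕ α) :=
        φ.relabel (Sum.elim (Sum.map id e.symm) (fun i => i.elim0))
      have hψ : ∀ v : α → 𝕄, ψ.Realize (Sum.elim (fun x : A => (x : 𝕄)) v) ↔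
          φ.Realize (Sum.elim (Sum.elim (fun x : A => (x : 𝕄)) (v ∘ e.symm)) c) := by
        intro v
        simp only [ψ, Formula.realize_relabel]
        refine iff_of_eq (congrArg _ ?_)
        funext x
        rcases x with (x | x) | x
        · rfl
        · rfl
        · exact x.elim0
      rw [← hψ, ← hψ]
      exact h' {v | ψ.Realize (Sum.elim (fun x : A => (x : 𝕄)) v)}
        (definable_iff_exists_formula_sum.2 ⟨ψ, rfl⟩))
  refine ⟨σ, fun x hx => hσ (Sum.inl ⟨x, hx⟩), fun i => ?_⟩
  simpa using hσ (Sum.inr (e i))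

end Basics

section Generic

variable {L : FirstOrder.Language.{u, u}} {𝕄 : Type u} [L.Structure 𝕄] {α : Type v} {β : Type w}
  {κ : Cardinal.{u}} {Ms : Set 𝕄}

/-- `σ` fixes the set `A` pointwise. -/
def Fixes (σ : 𝕄 ≃[L] 𝕄) (A : Set 𝕄) : Prop := ∀ x ∈ A, σ x = x

theorem Fixes.refl (A : Set 𝕄) : Fixes (Language.Equiv.refl L 𝕄) A := fun _ _ => rfl

theorem Fixes.comp {σ τ : 𝕄 ≃[L] 𝕄} {A : Set 𝕄} (hσ : Fixes σ A) (hτ : Fixes τ A) :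
    Fixes (σ.comp τ) A := fun x hx => by
  rw [Language.Equiv.comp_apply, hτ x hx, hσ x hx]

theorem Fixes.symm {σ : 𝕄 ≃[L] 𝕄} {A : Set 𝕄} (hσ : Fixes σ A) : Fixes σ.symm A :=
  fun x hx => by
    nth_rewrite 1 [← hσ x hx]
    exact σ.symm_apply_apply x

theorem Fixes.mono {σ : 𝕄 ≃[L] 𝕄} {A B : Set 𝕄} (hσ : Fixes σ B) (h : A ⊆ B) : Fixes σ A :=
  fun x hx => hσ x (h hx)

theorem Fixes.image_eq {σ : 𝕄 ≃[L] 𝕄} {A : Set 𝕄} (hσ : Fixes σ A) : σ '' A = A :=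
  (image_congr hσ).trans (image_id' A)

/-- `d` realizes over `A` the average type of the ultrafilter `U` on tuples from `Ms`. -/
def Generic (L : FirstOrder.Language.{u, u}) {𝕄 : Type u} [L.Structure 𝕄] {Ms : Set 𝕄}
    (U : Ultrafilter (α → Ms)) (A : Set 𝕄) (d : α → 𝕄) : Prop :=
  ∀ D : Set (α → 𝕄), A.Definable L D → (∀ᶠ m in (U : Filter (α → Ms)), (fun i => (m i : 𝕄)) ∈ D) →
    d ∈ D

theorem Generic.mono {U : Ultrafilter (α → Ms)} {A B : Set 𝕄} {d : α → 𝕄}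
    (h : Generic L U B d) (hAB : A ⊆ B) : Generic L U A d :=
  fun D hD => h D (hD.mono hAB)

theorem Generic.eventually_of_mem {U : Ultrafilter (α → Ms)} {A : Set 𝕄} {d : α → 𝕄}
    (h : Generic L U A d) {D : Set (α → 𝕄)} (hD : A.Definable L D) (hd : d ∈ D) :
    ∀ᶠ m in (U : Filter (α → Ms)), (fun i => (m i : 𝕄)) ∈ D :=
  (U.em _).resolve_right fun h' => h Dᶜ hD.compl h' hd

theorem exists_generic [Countable α] (hm : IsMonster L 𝕄 κ) (U : Ultrafilter (α → Ms)) {A : Set 𝕄}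
    (hA : #A < κ) : ∃ d, Generic L U A d := by
  obtain ⟨d, hd⟩ := hm.exists_mem_sInter hA
    {D : Set (α → 𝕄) | A.Definable L D ∧
      ∀ᶠ m in (U : Filter (α → Ms)), (fun i => (m i : 𝕄)) ∈ D}
    (fun D hD => hD.1) (fun t ht hfin => by
      have h : ∀ᶠ m in (U : Filter (α → Ms)), ∀ D ∈ t, (fun i => (m i : 𝕄)) ∈ D :=
        (eventually_all_finite hfin).2 fun D hD => (ht hD).2
      obtain ⟨m, hm⟩ := h.exists
      exact ⟨_, hm⟩)
  exact ⟨d, fun D hD hU => hd D ⟨hD, hU⟩⟩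

theorem Generic.exists_equiv [Countable α] (hm : IsMonster L 𝕄 κ) {U : Ultrafilter (α → Ms)}
    {A : Set 𝕄} (hA : #A < κ) {d d' : α → 𝕄} (hd : Generic L U A d) (hd' : Generic L U A d') :
    ∃ σ : 𝕄 ≃[L] 𝕄, Fixes σ A ∧ σ ∘ d = d' := by
  obtain ⟨σ, hσ, h⟩ := hm.exists_equiv hA fun D hD h => hd' D hD (hd.eventually_of_mem hD h)
  exact ⟨σ, hσ, funext h⟩

theorem Generic.image {U : Ultrafilter (α → Ms)} {A : Set 𝕄} {d : α → 𝕄}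
    (h : Generic L U A d) {σ : 𝕄 ≃[L] 𝕄} (hσ : Fixes σ Ms) : Generic L U (σ '' A) (σ ∘ d) := by
  intro D hD hU
  refine h _ (Definable.preimage_equiv σ hD) (hU.mono fun m hm => ?_)
  simpa only [mem_ofPred_eq, hσ _ (m _).2] using hm

theorem Generic.comp {U : Ultrafilter (α → Ms)} {A : Set 𝕄} {d : α → 𝕄}
    (h : Generic L U A d) (f : β → α) : Generic L (U.map (· ∘ f)) A (d ∘ f) :=
  fun _ hD hU => h _ (hD.preimage_comp f) hU

/-- The filter on tuples from `Ms` generated by the formulas in the type of `a` over `Ms`. -/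
def typeFilter (L : FirstOrder.Language.{u, u}) {𝕄 : Type u} [L.Structure 𝕄] (Ms : Set 𝕄)
    (a : α → 𝕄) : Filter (α → Ms) where
  sets := {S | ∃ D : Set (α → 𝕄), Ms.Definable L D ∧ a ∈ D ∧
    ∀ m : α → Ms, (fun i => (m i : 𝕄)) ∈ D → m ∈ S}
  univ_sets := ⟨univ, definable_univ, mem_univ _, fun _ _ => mem_univ _⟩
  sets_of_superset := fun ⟨D, hD, ha, h⟩ hST => ⟨D, hD, ha, fun m hm => hST (h m hm)⟩
  inter_sets := fun ⟨D, hD, ha, h⟩ ⟨D', hD', ha', h'⟩ =>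
    ⟨D ∩ D', hD.inter hD', ⟨ha, ha'⟩, fun m hm => ⟨h m hm.1, h' m hm.2⟩⟩

theorem mem_typeFilter {a : α → 𝕄} {S : Set (α → Ms)} : S ∈ typeFilter L Ms a ↔
    ∃ D : Set (α → 𝕄), Ms.Definable L D ∧ a ∈ D ∧
      ∀ m : α → Ms, (fun i => (m i : 𝕄)) ∈ D → m ∈ S := Iff.rfl

theorem typeFilter_neBot [Finite α] (hMs : IsElemSubmodel L Ms) (a : α → 𝕄) :
    (typeFilter L Ms a).NeBot := by
  refine neBot_iff.2 fun h => ?_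
  obtain ⟨D, hD, ha, h⟩ := mem_typeFilter.1 (empty_mem_iff_bot.2 h)
  obtain ⟨m, hm⟩ := hMs.exists_mem hD ⟨a, ha⟩
  exact h m hm

theorem tendsto_typeFilter (a : α → 𝕄) (f : β → α) :
    Tendsto (· ∘ f) (typeFilter L Ms a) (typeFilter L Ms (a ∘ f)) := by
  rintro S ⟨D, hD, ha, h⟩
  exact ⟨_, hD.preimage_comp f, ha, fun m hm => h _ hm⟩

theorem typeFilter_le_image {σ : 𝕄 ≃[L] 𝕄} (hσ : Fixes σ Ms) (a : α → 𝕄) :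
    typeFilter L Ms a ≤ typeFilter L Ms (σ ∘ a) := by
  rintro S ⟨D, hD, ha, h⟩
  refine ⟨_, Definable.preimage_equiv σ (hσ.image_eq.symm ▸ hD), ha, fun m hm => h m ?_⟩
  simpa only [mem_ofPred_eq, hσ _ (m _).2] using hm

theorem typeFilter_image {σ : 𝕄 ≃[L] 𝕄} (hσ : Fixes σ Ms) (a : α → 𝕄) :
    typeFilter L Ms (σ ∘ a) = typeFilter L Ms a := by
  refine le_antisymm ?_ (typeFilter_le_image hσ a)
  convert typeFilter_le_image hσ.symm (σ ∘ a) using 2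
  funext i
  exact (σ.symm_apply_apply _).symm

theorem generic_iff_le_typeFilter {U : Ultrafilter (α → Ms)} {a : α → 𝕄} :
    Generic L U Ms a ↔ (U : Filter (α → Ms)) ≤ typeFilter L Ms a := by
  constructor
  · rintro h S ⟨D, hD, ha, hS⟩
    exact (h.eventually_of_mem hD ha).mono hS
  · intro h D hD hU
    by_contra ha
    have h' : ∀ᶠ m in (U : Filter (α → Ms)), (fun i => (m i : 𝕄)) ∈ Dᶜ :=
      h (mem_typeFilter.2 ⟨Dᶜ, hD.compl, ha, fun m hm => hm⟩)
    obtain ⟨m, hm, hm'⟩ := (hU.and h').exists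
    exact hm' hm

end Generic

section Ramsey

variable {L : FirstOrder.Language.{u, u}} {𝕄 : Type u} [L.Structure 𝕄] {ι : Type}
  {κ : Cardinal.{u}} {Ms : Set 𝕄} {c : ι → 𝕄}

/-- The elements of `Ms` together with all entries of the tuples in `C`. -/
def params (Ms : Set 𝕄) (C : Set (ι → 𝕄)) : Set 𝕄 := Ms ∪ ⋃ e ∈ C, range e

theorem subset_params (C : Set (ι → 𝕄)) : Ms ⊆ params Ms C := subset_union_left

theorem params_mono {C C' : Set (ι → 𝕄)} (h : C ⊆ C') : params Ms C ⊆ params Ms C' :=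
  union_subset_union_right _ (biUnion_subset_biUnion_left h)

theorem apply_mem_params {C : Set (ι → 𝕄)} {e : ι → 𝕄} (he : e ∈ C) (i : ι) :
    e i ∈ params Ms C :=
  Or.inr (mem_biUnion he (mem_range_self i))

theorem params_empty : params Ms (∅ : Set (ι → 𝕄)) = Ms := by simp [params]

theorem Fixes.comp_eq {C : Set (ι → 𝕄)} {σ : 𝕄 ≃[L] 𝕄} (hσ : Fixes σ (params Ms C))
    {e : ι → 𝕄} (he : e ∈ C) : σ ∘ e = e :=
  funext fun i => hσ _ (apply_mem_params he i)

theorem Fixes.image_params {σ : 𝕄 ≃[L] 𝕄} (hσ : Fixes σ Ms) (C : Set (ι → 𝕄)) :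
    σ '' params Ms C = params Ms ((σ ∘ ·) '' C) := by
  simp only [params, image_union, hσ.image_eq, image_iUnion, biUnion_image, range_comp]

theorem mk_params_lt [Countable ι] (hm : IsMonster L 𝕄 κ) (hMs : #Ms < κ) {C : Set (ι → 𝕄)}
    (hC : C.Countable) : #(params Ms C) < κ := by
  refine (mk_union_le _ _).trans_lt (add_lt_of_lt hm.1.le hMs ?_)
  exact ((hC.biUnion fun e _ => countable_range e).le_aleph0).trans_lt hm.1

/-- The orbit of `c` under the automorphisms fixing `Ms` pointwise. -/
def orbit (L : FirstOrder.Language.{u, u}) {𝕄 : Type u} [L.Structure 𝕄] (Ms : Set 𝕄) (c : ι → 𝕄) :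
    Set (ι → 𝕄) := {e | ∃ σ : 𝕄 ≃[L] 𝕄, Fixes σ Ms ∧ σ ∘ c = e}

theorem self_mem_orbit : c ∈ orbit L Ms c := ⟨_, Fixes.refl Ms, rfl⟩

theorem comp_mem_orbit {σ : 𝕄 ≃[L] 𝕄} (hσ : Fixes σ Ms) {e : ι → 𝕄} (he : e ∈ orbit L Ms c) :
    (σ ∘ e) ∈ orbit L Ms c := by
  obtain ⟨τ, hτ, rfl⟩ := he
  exact ⟨σ.comp τ, hσ.comp hτ, rfl⟩

/-- `S` is monochromatically unavoidable in the orbit of `c`: for every finite part `W` of the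
orbit there is a finite part `Z` such that every coloring of `Z` has a copy of `S` avoiding
the color or a copy of `W` having the color. -/
def Ramsey (L : FirstOrder.Language.{u, u}) {𝕄 : Type u} [L.Structure 𝕄] (Ms : Set 𝕄)
    (c : ι → 𝕄) (S : Set (ι → 𝕄)) : Prop :=
  ∀ W ⊆ orbit L Ms c, W.Finite → ∃ Z ⊆ orbit L Ms c, Z.Finite ∧ ∀ B : Set (ι → 𝕄),
    (∃ σ : 𝕄 ≃[L] 𝕄, Fixes σ Ms ∧ ∀ s ∈ S, (σ ∘ s) ∈ Z \ B) ∨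
      ∃ σ : 𝕄 ≃[L] 𝕄, Fixes σ Ms ∧ ∀ w ∈ W, (σ ∘ w) ∈ Z ∩ B

theorem ramsey_empty : Ramsey L Ms c ∅ := fun W hW hfin =>
  ⟨W, hW, hfin, fun _ => Or.inl ⟨_, Fixes.refl Ms, fun _ h => h.elim⟩⟩

theorem ramsey_singleton {a : ι → 𝕄} (ha : a ∈ orbit L Ms c) : Ramsey L Ms c {a} := by
  intro W hW hfin
  refine ⟨insert c W, insert_subset self_mem_orbit hW, hfin.insert c, fun B => ?_⟩
  by_cases h : insert c W ⊆ B
  · exact Or.inr ⟨_, Fixes.refl Ms, fun w hw =>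
      ⟨mem_insert_of_mem _ hw, h (mem_insert_of_mem _ hw)⟩⟩
  · obtain ⟨w, hw, hwB⟩ := not_subset.1 h
    obtain ⟨σ, hσ, rfl⟩ := ha
    obtain ⟨τ, hτ, rfl⟩ := insert_subset self_mem_orbit hW hw
    refine Or.inl ⟨τ.comp σ.symm, hτ.comp hσ.symm, ?_⟩
    rintro s rfl
    have : (τ.comp σ.symm) ∘ σ ∘ c = τ ∘ c :=
      funext fun i => congrArg τ (σ.symm_apply_apply (c i))
    rw [this]
    exact ⟨hw, hwB⟩

theorem Ramsey.image {S : Set (ι → 𝕄)} (hS : Ramsey L Ms c S) {ρ : 𝕄 ≃[L] 𝕄}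
    (hρ : Fixes ρ Ms) : Ramsey L Ms c ((ρ ∘ ·) '' S) := by
  intro W hW hfin
  obtain ⟨Z, hZ, hZfin, h⟩ := hS W hW hfin
  refine ⟨Z, hZ, hZfin, fun B => (h B).imp_left ?_⟩
  rintro ⟨σ, hσ, hs⟩
  refine ⟨σ.comp ρ.symm, hσ.comp hρ.symm, ?_⟩
  rintro _ ⟨s, hs', rfl⟩
  have : (σ.comp ρ.symm) ∘ ρ ∘ s = σ ∘ s :=
    funext fun i => congrArg σ (ρ.symm_apply_apply (s i))
  rw [this]
  exact hs s hs'

theorem Ramsey.range_union [Finite ι] (hm : IsMonster L 𝕄 κ) (hMs : #Ms < κ) {F : Type v}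
    [Finite F] {J : F → ι → 𝕄} {K : Set (ι → 𝕄)} (hJ : Ramsey L Ms c (range J))
    (hK : Ramsey L Ms c K) (P : Ultrafilter (F × ι → Ms))
    (hP : Generic L P (params Ms K) (fun p => J p.1 p.2)) : Ramsey L Ms c (range J ∪ K) := by
  intro W hW hfin
  obtain ⟨ZJ, hZJ, hZJfin, hJ⟩ := hJ W hW hfin
  obtain ⟨ZK, hZK, hZKfin, hK⟩ := hK W hW hfin
  have hZKcard := mk_params_lt hm hMs hZKfin.countable
  obtain ⟨D, hD⟩ := exists_generic hm P hZKcard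
  have hτ : ∀ g : F → ι → 𝕄, ∃ τ : 𝕄 ≃[L] 𝕄, Fixes τ Ms ∧
      ∀ σ : 𝕄 ≃[L] 𝕄, Fixes σ Ms → (∀ f, σ ∘ J f = g f) → ∀ f i, τ (D (f, i)) = g f i := by
    intro g
    by_cases h : ∃ σ : 𝕄 ≃[L] 𝕄, Fixes σ Ms ∧ ∀ f, σ ∘ J f = g f
    · obtain ⟨σ, hσ, hg⟩ := h
      obtain ⟨ρ, hρ, h⟩ := (hD.mono (subset_params _)).exists_equiv hm hMs
        (hP.mono (subset_params _))
      refine ⟨σ.comp ρ, hσ.comp hρ, fun _ _ _ f i => ?_⟩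
      rw [← hg f]
      exact congrArg σ (congrFun h (f, i))
    · exact ⟨_, Fixes.refl Ms, fun σ hσ hg => (h ⟨σ, hσ, hg⟩).elim⟩
  choose τ hτfix hτ using hτ
  let G : Set (F → ι → 𝕄) := {g | ∀ f, g f ∈ ZJ}
  have hG : G.Finite := Finite.pi' fun _ => hZJfin
  refine ⟨ZJ ∪ ⋃ g ∈ G, (τ g ∘ ·) '' ZK, union_subset hZJ (iUnion₂_subset ?_),
    hZJfin.union (hG.biUnion fun g _ => hZKfin.image _), fun B => ?_⟩
  · rintro g - _ ⟨e, he, rfl⟩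
    exact comp_mem_orbit (hτfix g) (hZK he)
  obtain ⟨σ, hσ, h⟩ | ⟨σ, hσ, h⟩ := hJ B
  swap
  · exact Or.inr ⟨σ, hσ, fun w hw => ⟨Or.inl (h w hw).1, (h w hw).2⟩⟩
  let g : F → ι → 𝕄 := fun f => σ ∘ J f
  have hg : g ∈ G := fun f => (h _ (mem_range_self f)).1
  have hmem : ∀ e ∈ ZK, (τ g ∘ e) ∈ ZJ ∪ ⋃ g ∈ G, (τ g ∘ ·) '' ZK := fun e he =>
    Or.inr (mem_biUnion hg (mem_image_of_mem _ he))
  obtain ⟨σ', hσ', h'⟩ | ⟨σ', hσ', h'⟩ := hK {e | (τ g ∘ e) ∈ B}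
  swap
  · exact Or.inr ⟨(τ g).comp σ', (hτfix g).comp hσ', fun w hw => ⟨hmem _ (h' w hw).1, (h' w hw).2⟩⟩
  have hsub : params Ms ((σ' ∘ ·) '' K) ⊆ params Ms ZK := params_mono (by
    rintro _ ⟨k, hk, rfl⟩
    exact (h' k hk).1)
  have hJ' := hP.image hσ'
  rw [hσ'.image_params] at hJ'
  obtain ⟨ρ, hρ, hρD⟩ := hJ'.exists_equiv hm ((mk_le_mk_of_subset hsub).trans_lt hZKcard)
    (hD.mono hsub)
  refine Or.inl ⟨(τ g).comp (ρ.comp σ'), (hτfix g).comp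
    ((hρ.mono (subset_params _)).comp hσ'), ?_⟩
  rintro s (⟨f, rfl⟩ | hs)
  · have : ((τ g).comp (ρ.comp σ')) ∘ J f = σ ∘ J f := by
      funext i
      refine Eq.trans ?_ (hτ g σ hσ (fun _ => rfl) f i)
      exact congrArg (τ g) (congrFun hρD (f, i))
    rw [this]
    exact ⟨Or.inl (h _ (mem_range_self f)).1, (h _ (mem_range_self f)).2⟩
  · have : ((τ g).comp (ρ.comp σ')) ∘ s = τ g ∘ (σ' ∘ s) := by
      conv_rhs => rw [← hρ.comp_eq (mem_image_of_mem _ hs)]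
      rfl
    rw [this]
    exact ⟨hmem _ (h' s hs).1, (h' s hs).2⟩

/-- The tuple obtained by concatenating the members of `S`. -/
def flatten (S : Set (ι → 𝕄)) : S × ι → 𝕄 := fun p => p.1.1 p.2

/-- The entry at `s` of a concatenated tuple. -/
def entry {S : Set (ι → 𝕄)} (s : S) (m : S × ι → Ms) : ι → Ms := fun i => m (s, i)

/-- Finite subsets of the orbit of `c` are approximated in `Ms` by tuples with entries in `B`. -/
def Full (L : FirstOrder.Language.{u, u}) {𝕄 : Type u} [L.Structure 𝕄] {Ms : Set 𝕄}
    (c : ι → 𝕄) (B : Set (ι → Ms)) : Prop :=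
  ∀ W ⊆ orbit L Ms c, W.Finite → ∃ᶠ m in typeFilter L Ms (flatten W), ∀ w, entry w m ∈ B

theorem full_univ [Finite ι] (hMs : IsElemSubmodel L Ms) : Full L c (univ : Set (ι → Ms)) := by
  intro W _ hfin
  have := hfin.to_subtype
  have := typeFilter_neBot hMs (flatten W)
  exact Frequently.of_forall fun _ _ => mem_univ _

theorem Full.nonempty {B : Set (ι → Ms)} (h : Full L c B) : B.Nonempty := by
  obtain ⟨m, hm⟩ := (h {c} (singleton_subset_iff.2 self_mem_orbit) (finite_singleton c)).exists
  exact ⟨_, hm ⟨c, rfl⟩⟩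

theorem tendsto_typeFilter_flatten {S Z : Set (ι → 𝕄)} {σ : 𝕄 ≃[L] 𝕄} (hσ : Fixes σ Ms)
    (h : ∀ s : S, (σ ∘ s.1) ∈ Z) :
    Tendsto (fun (m : Z × ι → Ms) (p : S × ι) => m (⟨_, h p.1⟩, p.2))
      (typeFilter L Ms (flatten Z)) (typeFilter L Ms (flatten S)) := by
  rw [← typeFilter_image hσ (flatten S)]
  exact tendsto_typeFilter (flatten Z) fun p : S × ι => (⟨_, h p.1⟩, p.2)

theorem Full.diff {A B : Set (ι → Ms)} (hB : Full L c B) {S : Set (ι → 𝕄)} (hfin : S.Finite)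
    (hS : Ramsey L Ms c S) (hA : ∀ᶠ m in typeFilter L Ms (flatten S), ∃ s, entry s m ∉ A) :
    Full L c (B \ A) := by
  intro W hW hWfin
  obtain ⟨Z, hZ, hZfin, h⟩ := hS W hW hWfin
  have : (typeFilter L Ms (flatten Z) ⊓ 𝓟 {m | ∀ w, entry w m ∈ B}).NeBot :=
    frequently_mem_iff_neBot.1 (hB Z hZ hZfin)
  obtain ⟨V, hV⟩ := Ultrafilter.exists_le
    (typeFilter L Ms (flatten Z) ⊓ 𝓟 {m | ∀ w, entry w m ∈ B})
  have hVB : ∀ᶠ m in (V : Filter (Z × ι → Ms)), ∀ w, entry w m ∈ B :=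
    (hV.trans inf_le_right) (mem_principal_self _)
  have hVZ := hV.trans inf_le_left
  obtain ⟨σ, hσ, h⟩ | ⟨σ, hσ, h⟩ :=
    h {e | ∃ he : e ∈ Z, ∀ᶠ m in (V : Filter _), entry ⟨e, he⟩ m ∉ A}
  · have := hfin.to_subtype
    have h1 := ((tendsto_typeFilter_flatten hσ fun s : S => (h s.1 s.2).1).mono_left
      hVZ).eventually hA
    have h2 : ∀ᶠ m in (V : Filter _), ∀ s : S, entry ⟨_, (h s.1 s.2).1⟩ m ∈ A :=
      eventually_all.2 fun s =>
      (V.em _).resolve_right fun hs => (h s.1 s.2).2 ⟨(h s.1 s.2).1, hs⟩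
    obtain ⟨m, ⟨s, hs⟩, hm⟩ := (h1.and h2).exists
    exact (hs (hm s)).elim
  · have := hWfin.to_subtype
    refine (tendsto_typeFilter_flatten hσ fun w : W => (h w.1 w.2).1).frequently
      (Frequently.filter_mono (Eventually.frequently ?_) hVZ)
    have h2 : ∀ᶠ m in (V : Filter _), ∀ w : W, entry ⟨_, (h w.1 w.2).1⟩ m ∉ A :=
      eventually_all.2 fun w => (h w.1 w.2).2.2
    exact (hVB.and h2).mono fun m hm w => ⟨hm.1 ⟨_, (h w.1 w.2).1⟩, hm.2 w⟩

/-- Every finite Ramsey set in the orbit of `c` can be approximated by tuples whose entries all lie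
in a prescribed member of `U`. -/
def Universal (L : FirstOrder.Language.{u, u}) {𝕄 : Type u} [L.Structure 𝕄] {Ms : Set 𝕄}
    (c : ι → 𝕄) (U : Ultrafilter (ι → Ms)) : Prop :=
  ∀ S ⊆ orbit L Ms c, S.Finite → Ramsey L Ms c S → ∀ A ∈ U,
    ∃ᶠ m in typeFilter L Ms (flatten S), ∀ s, entry s m ∈ A

theorem exists_universal [Finite ι] (hMs : IsElemSubmodel L Ms) (c : ι → 𝕄) :
    ∃ U : Ultrafilter (ι → Ms), Universal L c U := by
  let 𝒜 : Set (Set (ι → Ms)) := {B | ∃ S ⊆ orbit L Ms c, S.Finite ∧ Ramsey L Ms c S ∧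
    ∀ᶠ m in typeFilter L Ms (flatten S), ∃ s, entry s m ∈ B}
  have hfull : ∀ t : Set (Set (ι → Ms)), t.Finite → t ⊆ 𝒜 → Full L c (⋂₀ t) := by
    intro t ht
    induction t, ht using Set.Finite.induction_on with
    | empty => exact fun _ => by simpa using full_univ hMs
    | @insert B t _ _ ih =>
      intro h
      obtain ⟨S, -, hfin, hR, hS⟩ := h (mem_insert B t)
      have := (ih fun B' hB' => h (mem_insert_of_mem _ hB')).diff (A := Bᶜ) hfin hR
        (by simpa only [notMem_compl_iff] using hS)
      rwa [sdiff_compl, inter_comm, ← sInter_insert] at this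
  have : (generate 𝒜).NeBot := generate_neBot_iff.2 fun t ht hfin => (hfull t hfin ht).nonempty
  obtain ⟨U, hU⟩ := Ultrafilter.exists_le (generate 𝒜)
  refine ⟨U, fun S hS hfin hR A hA => by_contra fun h => ?_⟩
  have hA' : Aᶜ ∈ U := hU (mem_generate_of_mem ⟨S, hS, hfin, hR,
    (not_frequently.1 h).mono fun m hm => not_forall.1 hm⟩)
  exact Ultrafilter.compl_notMem_iff.2 hA hA'

theorem Universal.le_typeFilter {U : Ultrafilter (ι → Ms)} (hU : Universal L c U) :
    (U : Filter (ι → Ms)) ≤ typeFilter L Ms c := by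
  rintro A ⟨D, hD, hc, hA⟩
  refine (U.mem_or_compl_mem A).resolve_right fun hA' => ?_
  have h := hU {c} (singleton_subset_iff.2 self_mem_orbit) (finite_singleton c)
    (ramsey_singleton self_mem_orbit) _ hA'
  have h' : ∀ᶠ m in typeFilter L Ms (flatten ({c} : Set (ι → 𝕄))),
      entry ⟨c, mem_singleton c⟩ m ∈ A :=
    (tendsto_typeFilter (flatten ({c} : Set (ι → 𝕄)))
      fun i : ι => (⟨c, mem_singleton c⟩, i)).eventually
      (mem_typeFilter.2 ⟨D, hD, hc, hA⟩)
  obtain ⟨m, hm, hm'⟩ := (h.and_eventually h').exists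
  exact hm _ hm'

theorem Universal.exists_ultrafilter {U : Ultrafilter (ι → Ms)} (hU : Universal L c U)
    {S : Set (ι → 𝕄)} (hS : S ⊆ orbit L Ms c) (hfin : S.Finite) (hR : Ramsey L Ms c S) :
    ∃ Q : Ultrafilter (S × ι → Ms), (Q : Filter _) ≤ typeFilter L Ms (flatten S) ∧
      ∀ s, Q.map (entry s) = U := by
  let 𝒢 : Filter (S × ι → Ms) := (U : Filter (ι → Ms)).lift' fun A => {m | ∀ s, entry s m ∈ A}
  have hmono : Monotone fun A : Set (ι → Ms) => {m : S × ι → Ms | ∀ s, entry s m ∈ A} :=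
    fun A B hAB m hm s => hAB (hm s)
  have : (typeFilter L Ms (flatten S) ⊓ 𝒢).NeBot := by
    refine inf_neBot_iff.2 fun X hX Y hY => ?_
    obtain ⟨A, hA, hAY⟩ := (mem_lift'_sets hmono).1 hY
    obtain ⟨m, hm, hmX⟩ := ((hU S hS hfin hR A hA).and_eventually hX).exists
    exact ⟨m, hmX, hAY hm⟩
  obtain ⟨Q, hQ⟩ := Ultrafilter.exists_le (typeFilter L Ms (flatten S) ⊓ 𝒢)
  refine ⟨Q, hQ.trans inf_le_left, fun s => Ultrafilter.eq_of_le fun A hA => ?_⟩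
  have : ∀ᶠ m in (Q : Filter (S × ι → Ms)), ∀ s, entry s m ∈ A :=
    (hQ.trans inf_le_right) ((mem_lift'_sets hmono).2 ⟨A, hA, Subset.rfl⟩)
  exact this.mono fun m hm => hm s

end Ramsey

section Morley

variable {L : FirstOrder.Language.{u, u}} {𝕄 : Type u} [L.Structure 𝕄] {ι ι' : Type}
  {κ : Cardinal.{u}} {Ms : Set 𝕄}

/-- The first `l` terms of `d` form a Morley sequence in the average type of `V`. -/
def MorleySeg (L : FirstOrder.Language.{u, u}) {𝕄 : Type u} [L.Structure 𝕄] {Ms : Set 𝕄}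
    (V : Ultrafilter (ι → Ms)) (l : ℕ) (d : ℕ → ι → 𝕄) : Prop :=
  ∀ n < l, Generic L V (params Ms (d '' Iio n)) (d n)

theorem MorleySeg.exists_equiv [Countable ι] (hm : IsMonster L 𝕄 κ) (hMs : #Ms < κ)
    {V : Ultrafilter (ι → Ms)} {l : ℕ} {d d' : ℕ → ι → 𝕄} (hd : MorleySeg L V l d)
    (hd' : MorleySeg L V l d') :
    ∃ σ : 𝕄 ≃[L] 𝕄, Fixes σ Ms ∧ ∀ i < l, σ ∘ d i = d' i := by
  induction l with
  | zero => exact ⟨_, Fixes.refl Ms, fun i hi => absurd hi i.not_lt_zero⟩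
  | succ l ih =>
    obtain ⟨σ, hσ, h⟩ := ih (fun n hn => hd n (hn.trans l.lt_succ_self))
      fun n hn => hd' n (hn.trans l.lt_succ_self)
    have h1 := (hd l l.lt_succ_self).image hσ
    rw [hσ.image_params, image_image,
      image_congr (s := Iio l) fun i hi => h i hi] at h1
    obtain ⟨ρ, hρ, h2⟩ := h1.exists_equiv hm
      (mk_params_lt hm hMs ((finite_Iio l).image d').countable) (hd' l l.lt_succ_self)
    refine ⟨ρ.comp σ, (hρ.mono (subset_params _)).comp hσ, fun i hi => ?_⟩
    obtain hi | rfl := Nat.lt_succ_iff_lt_or_eq.1 hi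
    · have h3 := hρ.comp_eq (mem_image_of_mem d' hi)
      conv_rhs => rw [← h3, ← h i hi]
      rfl
    · exact h2

theorem MorleySeg.comp {V : Ultrafilter (ι → Ms)} {l : ℕ} {d : ℕ → ι → 𝕄}
    (hd : MorleySeg L V l d) (f : ι' → ι) :
    MorleySeg L (V.map (· ∘ f)) l fun n => d n ∘ f := by
  intro n hn
  refine ((hd n hn).comp f).mono ?_
  rw [← image_image (· ∘ f) d, params, biUnion_image]
  exact union_subset_union_right _ (iUnion₂_mono fun e _ => range_comp_subset_range f e)

theorem MorleySeg.strictMono {V : Ultrafilter (ι → Ms)} {d : ℕ → ι → 𝕄}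
    (hd : ∀ l, MorleySeg L V l d) {f : ℕ → ℕ} (hf : StrictMono f) (l : ℕ) :
    MorleySeg L V l (d ∘ f) := by
  intro n _
  refine (hd (f n + 1) (f n) (Nat.lt_succ_self _)).mono (params_mono ?_)
  rw [image_comp]
  exact image_mono (by rintro _ ⟨i, hi, rfl⟩; exact hf hi)

theorem MorleySeg.image {V : Ultrafilter (ι → Ms)} {l : ℕ} {d : ℕ → ι → 𝕄}
    (hd : MorleySeg L V l d) {σ : 𝕄 ≃[L] 𝕄} (hσ : Fixes σ Ms) :
    MorleySeg L V l fun n => σ ∘ d n := by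
  intro n hn
  have h := (hd n hn).image hσ
  rwa [hσ.image_params, image_image] at h

theorem exists_morleySeg [Countable ι] (hm : IsMonster L 𝕄 κ) (hMs : #Ms < κ)
    {V : Ultrafilter (ι → Ms)} {c : ι → 𝕄} (hV : (V : Filter (ι → Ms)) ≤ typeFilter L Ms c) :
    ∃ d : ℕ → ι → 𝕄, d 0 = c ∧ ∀ l, MorleySeg L V l d := by
  have h : ∀ C : Set (ι → 𝕄), ∃ e, C.Finite → Generic L V (params Ms C) e := by
    intro C
    by_cases hC : C.Finite
    · obtain ⟨e, he⟩ := exists_generic hm V (mk_params_lt hm hMs hC.countable)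
      exact ⟨e, fun _ => he⟩
    · exact ⟨c, fun h => (hC h).elim⟩
  choose g hg using h
  let C : ℕ → Set (ι → 𝕄) := fun n => Nat.rec ∅ (fun _ C => insert (g C) C) n
  have hC : ∀ n, C n = (fun n => g (C n)) '' Iio n := by
    intro n
    induction n with
    | zero => simp [C]
    | succ n ih =>
      rw [← Order.succ_eq_add_one, Order.Iio_succ_eq_insert, image_insert_eq, ← ih]
      rfl
  have hd : ∀ l, MorleySeg L V l fun n => g (C n) := by
    intro l n _
    have hfin : (C n).Finite := by
      rw [hC]
      exact (finite_Iio n).image _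
    have h := hg _ hfin
    exact (hC n) ▸ h
  have h0 : Generic L V Ms (g (C 0)) := (hd 1 0 one_pos).mono (subset_params _)
  obtain ⟨σ, hσ, h⟩ := h0.exists_equiv hm hMs (generic_iff_le_typeFilter.2 hV)
  exact ⟨_, h, fun l => (hd l).image hσ⟩

/-- The global average type of an ultrafilter on tuples from `Ms`. -/
def averageType (L : FirstOrder.Language.{u, u}) {𝕄 : Type u} [L.Structure 𝕄] {Ms : Set 𝕄}
    {α : Type v} (U : Ultrafilter (α → Ms)) : GlobalType L 𝕄 α where
  carrier := {p | ∀ᶠ m in (U : Filter (α → Ms)),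
    p.2.1.Realize (Sum.elim (fun i => (m i : 𝕄)) p.2.2)}
  consistent := fun t ht => by
    obtain ⟨m, hm⟩ := ((eventually_all_finset t).2 fun p hp => ht hp).exists
    exact ⟨_, hm⟩
  complete := fun n φ c => (U.em _).imp_right fun h => h.mono fun m hm => hm

theorem averageType_finSatInM {α : Type v} (U : Ultrafilter (α → Ms)) :
    (averageType L U).FinSatInM Ms := fun t ht => by
  obtain ⟨m, hm⟩ := ((eventually_all_finset t).2 fun p hp => ht hp).exists
  exact ⟨_, fun i => (m i).2, hm⟩

theorem Generic.realizesType {α : Type v} {U : Ultrafilter (α → Ms)} {A : Set 𝕄} {d : α → 𝕄}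
    (h : Generic L U A d) : RealizesType (averageType L U) d A :=
  fun _ φ _ hc hU => h _ (definable_setOf_realize φ hc) hU

theorem params_image_Iio (d : ℕ → ι → 𝕄) (n : ℕ) :
    params Ms (d '' Iio n) = Ms ∪ ⋃ (j : ℕ) (_ : j < n), range (d j) := by
  rw [params, biUnion_image]
  rfl

theorem MorleySeg.coheirMorley {n : ℕ} {V : Ultrafilter (Fin n → Ms)} {d : ℕ → Fin n → 𝕄}
    (hd : ∀ l, MorleySeg L V l d) : CoheirMorley L Ms d :=
  ⟨averageType L V, averageType_finSatInM V, fun i => by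
    rw [← params_image_Iio]
    exact (hd (i + 1) i i.lt_succ_self).realizesType⟩

theorem RealizesType.generic {α : Type v} {q : GlobalType L 𝕄 α}
    {U : Ultrafilter (α → Ms)}
    (hU : ∀ p ∈ q.carrier, ∀ᶠ m in (U : Filter (α → Ms)),
      p.2.1.Realize (Sum.elim (fun i => (m i : 𝕄)) p.2.2))
    {A : Set 𝕄} {d : α → 𝕄} (h : RealizesType q d A) : Generic L U A d := by
  intro D hD hUD
  obtain ⟨n, φ, c, hc, hφ⟩ := exists_formula_of_definable hD
  rw [hφ]
  refine h n φ c hc ((q.complete n φ c).resolve_right fun hn => ?_)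
  obtain ⟨m, hm, hm'⟩ := (hUD.and (hU _ hn)).exists
  exact hm' ((hφ _).1 hm)

/-- A coheir Morley sequence starting with part of the tuple `c` is a Morley sequence in the
projection of an ultrafilter concentrating on the type of `c`. -/
theorem exists_ultrafilter_of_morleyIn [Finite ι] (hMs : IsElemSubmodel L Ms) {c : ι → 𝕄} {n : ℕ}
    (f : Fin n → ι) {q : GlobalType L 𝕄 (Fin n)} {B : ℕ → Fin n → 𝕄} (hB : MorleyIn q Ms B)
    (h0 : B 0 = c ∘ f) :
    ∃ V : Ultrafilter (ι → Ms), (V : Filter (ι → Ms)) ≤ typeFilter L Ms c ∧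
      ∀ l, MorleySeg L (V.map (· ∘ f)) l B := by
  let S : FmlP L 𝕄 (Fin n) → Set (ι → Ms) := fun p =>
    {m | p.2.1.Realize (Sum.elim (fun i => (m (f i) : 𝕄)) p.2.2)}
  have : (typeFilter L Ms c ⊓ generate (S '' q.carrier)).NeBot := by
    classical
    refine inf_neBot_iff.2 fun X hX Y hY => ?_
    obtain ⟨D, hD, hc, hX⟩ := mem_typeFilter.1 hX
    obtain ⟨t, hts, htfin, htY⟩ :=
      exists_subset_image_finite_and.1 (mem_generate_iff.1 hY)
    lift t to Finset (FmlP L 𝕄 (Fin n)) using htfin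
    obtain ⟨k, θ, e, he, hθ⟩ := exists_formula_of_definable (hD.image_comp f)
    have hθq : (⟨k, (θ, e)⟩ : FmlP L 𝕄 (Fin n)) ∈ q.carrier := by
      refine (q.complete k θ e).resolve_right fun hn => ?_
      refine hB.2 0 k θ.not e (fun i => Or.inl (he i)) hn ((hθ _).1 ?_)
      exact ⟨c, hc, h0.symm⟩
    obtain ⟨m, hmMs, hm⟩ := hB.1 (insert ⟨k, (θ, e)⟩ t) (by
      rw [Finset.coe_insert]
      exact insert_subset hθq hts)
    obtain ⟨v, hv, hvm⟩ := (hθ m).2 (hm _ (Finset.mem_insert_self _ _))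
    have hdef : Ms.Definable L {w : ι → 𝕄 | ∀ i, w (f i) = m i} := by
      rw [ofPred_forall]
      refine definable_iInter_of_finite fun i => ?_
      exact definable_setOf_realize
        ((Term.var (Sum.inl (f i))).equal (Term.var (Sum.inr (0 : Fin 1)))) fun _ => hmMs i
    obtain ⟨w, hwD, hw⟩ := hMs.exists_mem (hD.inter hdef) ⟨v, hv, fun i => congrFun hvm i⟩
    refine ⟨w, hX w hwD, htY ?_⟩
    rintro _ ⟨p, hp, rfl⟩
    have := hm p (Finset.mem_insert_of_mem hp)
    rwa [← funext hw] at this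
  obtain ⟨V, hV⟩ := Ultrafilter.exists_le (typeFilter L Ms c ⊓ generate (S '' q.carrier))
  refine ⟨V, hV.trans inf_le_left, fun l i _ => ?_⟩
  refine RealizesType.generic (q := q) (fun p hp => ?_) ?_
  · exact (hV.trans inf_le_right) (mem_generate_of_mem (mem_image_of_mem S hp))
  · rw [params_image_Iio]
    exact hB.2 i

/-- If the first `l` instances along some Morley sequence are consistent, then so are they along
any Morley sequence in the same average type. -/
theorem MorleySeg.realize_of_realize [Countable ι] (hm : IsMonster L 𝕄 κ) (hMs : #Ms < κ)
    {V : Ultrafilter (ι → Ms)} {l : ℕ} {d d' : ℕ → ι → 𝕄} (hd : MorleySeg L V l d)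
    (hd' : MorleySeg L V l d') {α : Type v} {φ : L.Formula (α ⊕ ι)}
    (h : ∃ a : α → 𝕄, ∀ i < l, φ.Realize (Sum.elim a (d i))) :
    ∃ a : α → 𝕄, ∀ i < l, φ.Realize (Sum.elim a (d' i)) := by
  obtain ⟨σ, -, hσ⟩ := hd.exists_equiv hm hMs hd'
  obtain ⟨a, ha⟩ := h
  refine ⟨σ ∘ a, fun i hi => ?_⟩
  have := (StrongHomClass.realize_formula σ φ).2 (ha i hi)
  rwa [Sum.comp_elim, hσ i hi] at this

end Morley

section Combs

variable {A : Type w} [DecidableEq A]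

theorem meet_prefix_left (s t : List A) : meet s t <+: s := by
  induction s generalizing t with
  | nil => cases t <;> exact List.nil_prefix
  | cons a s ih =>
    cases t with
    | nil => exact List.nil_prefix
    | cons b t =>
      rw [meet]
      split_ifs with h
      · exact (List.prefix_cons_inj a).2 (ih t)
      · exact List.nil_prefix

theorem meet_prefix_right (s t : List A) : meet s t <+: t := by
  induction s generalizing t with
  | nil => cases t <;> exact List.nil_prefix
  | cons a s ih =>
    cases t with
    | nil => exact List.nil_prefix
    | cons b t =>
      rw [meet]
      split_ifs with h
      · subst h
        exact (List.prefix_cons_inj a).2 (ih t)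
      · exact List.nil_prefix

theorem prefix_meet {p s t : List A} (hs : p <+: s) (ht : p <+: t) : p <+: meet s t := by
  induction p generalizing s t with
  | nil => exact List.nil_prefix
  | cons a p ih =>
    obtain ⟨s, rfl⟩ := hs
    obtain ⟨t, rfl⟩ := ht
    simp only [List.cons_append, meet, if_true]
    exact (List.prefix_cons_inj a).2 (ih (List.prefix_append _ _) (List.prefix_append _ _))

theorem foldl_meet_prefix (x : List A) (s : List (List A)) :
    s.foldl meet x <+: x ∧ ∀ y ∈ s, s.foldl meet x <+: y := by
  induction s generalizing x with
  | nil => simp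
  | cons z s ih =>
    obtain ⟨h1, h2⟩ := ih (meet x z)
    refine ⟨h1.trans (meet_prefix_left x z), fun y hy => ?_⟩
    obtain rfl | hy := List.mem_cons.1 hy
    · exact h1.trans (meet_prefix_right x y)
    · exact h2 y hy

theorem prefix_foldl_meet {p x : List A} {s : List (List A)} (hx : p <+: x)
    (hs : ∀ y ∈ s, p <+: y) : p <+: s.foldl meet x := by
  induction s generalizing x with
  | nil => exact hx
  | cons z s ih =>
    exact ih (prefix_meet hx (hs z List.mem_cons_self)) fun y hy => hs y (List.mem_cons_of_mem _ hy)

theorem combMeet_prefix {l : ℕ} (η : Fin l → List A) {i j : Fin l} (h : j ≤ i) :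
    combMeet η i <+: η j := by
  obtain ⟨h1, h2⟩ := foldl_meet_prefix (η i)
    (List.ofFn fun j : Fin i.val => η (Fin.castLE i.2.le j))
  obtain h | rfl := lt_or_eq_of_le h
  · exact h2 _ (List.mem_ofFn.2 ⟨⟨j, h⟩, rfl⟩)
  · exact h1

theorem prefix_combMeet {l : ℕ} {η : Fin l → List A} {i : Fin l} {p : List A}
    (h : ∀ j ≤ i, p <+: η j) : p <+: combMeet η i := by
  refine prefix_foldl_meet (h i le_rfl) fun y hy => ?_
  obtain ⟨j, rfl⟩ := List.mem_ofFn.1 hy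
  exact h _ (Fin.le_def.2 j.2.le)

theorem exists_branching_of_not_prefix {s t : List A} (hst : ¬ s <+: t) (hts : ¬ t <+: s) :
    ∃ μ x y, x ≠ y ∧ μ ++ [x] <+: s ∧ μ ++ [y] <+: t := by
  induction s generalizing t with
  | nil => exact (hst List.nil_prefix).elim
  | cons a s ih =>
    cases t with
    | nil => exact (hts List.nil_prefix).elim
    | cons b t =>
      by_cases h : a = b
      · subst h
        rw [List.prefix_cons_inj] at hst hts
        obtain ⟨μ, x, y, hxy, hx, hy⟩ := ih hst hts
        exact ⟨a :: μ, x, y, hxy, (List.prefix_cons_inj a).2 hx, (List.prefix_cons_inj a).2 hy⟩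
      · exact ⟨[], a, b, h, ⟨s, rfl⟩, ⟨t, rfl⟩⟩

theorem not_lex_append_true_false (μ s t : List Bool) :
    ¬ List.Lex (· < ·) (μ ++ [true] ++ s) (μ ++ [false] ++ t) := by
  induction μ with
  | nil =>
    intro h
    cases h with
    | rel h => exact absurd h (by decide)
  | cons a μ ih =>
    intro h
    cases h with
    | rel h => exact lt_irrefl _ h
    | cons h => exact ih h

theorem DescendingComb.exists_branching {l : ℕ} {η : Fin l → List Bool} (hη : DescendingComb η)
    {i : ℕ} (h : i + 1 < l) :
    ∃ μ, μ ++ [true] <+: η ⟨i + 1, h⟩ ∧ ∀ j < (⟨i + 1, h⟩ : Fin l), μ ++ [false] <+: η j := by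
  obtain ⟨hanti, hlex, hmeet⟩ := hη
  obtain ⟨h1, h2⟩ := hmeet i h
  let p := combMeet η ⟨i, by omega⟩
  have hp : ∀ j < (⟨i + 1, h⟩ : Fin l), p <+: η j := fun j hj =>
    combMeet_prefix η (Fin.le_def.2 (Nat.lt_succ_iff.1 hj))
  have h0 : (⟨0, by omega⟩ : Fin l) < ⟨i + 1, h⟩ := Fin.lt_def.2 i.succ_pos
  obtain ⟨μ, x, y, hxy, hx, hy⟩ := exists_branching_of_not_prefix (s := p) (t := η ⟨i + 1, h⟩)
    (fun hpre => h2 (h1.eq_of_length_le (prefix_combMeet fun j hj => by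
      obtain hj | rfl := lt_or_eq_of_le hj
      · exact hp j hj
      · exact hpre).length_le))
    (fun hpre => hanti _ _ h0.ne' (hpre.trans (hp _ h0)))
  obtain ⟨s, hs⟩ := hx.trans (hp _ h0)
  obtain ⟨t, ht⟩ := hy
  have hxy' : x = false ∧ y = true := by
    have := hlex _ _ h0
    rw [← hs, ← ht] at this
    cases x <;> cases y
    · exact (hxy rfl).elim
    · exact ⟨rfl, rfl⟩
    · exact (not_lex_append_true_false μ s t this).elim
    · exact (hxy rfl).elim
  obtain ⟨rfl, rfl⟩ := hxy'
  exact ⟨μ, ⟨t, ht⟩, fun j hj => hx.trans (hp j hj)⟩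

end Combs

section Tree

variable {L : FirstOrder.Language.{u, u}} {𝕄 : Type u} [L.Structure 𝕄] {ι : Type}
  {κ : Cardinal.{u}} {Ms : Set 𝕄} {c : ι → 𝕄}

/-- The part of height `n` of the tree `T` has Morley sequences in `V` as paths (read downwards)
and Morley sequences in `U` as descending combs. -/
structure IsMorleyTree (c : ι → 𝕄) (U V : Ultrafilter (ι → Ms)) (n : ℕ)
    (T : List Bool → ι → 𝕄) : Prop where
  mem_orbit : T '' {η | η.length < n} ⊆ orbit L Ms c
  ramsey : Ramsey L Ms c (T '' {η | η.length < n})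
  path : ∀ η : List Bool, η.length < n →
    Generic L V (params Ms (T '' {e | η <+: e ∧ e ≠ η ∧ e.length < n})) (T η)
  comb : ∀ μ η : List Bool, μ ++ [true] <+: η → η.length < n →
    Generic L U (params Ms (T '' {e | μ ++ [false] <+: e ∧ e.length < n})) (T η)

/-- The tree with root `a` and the trees `T false`, `T true` above it. -/
def joinTree {X : Type w} (a : X) (T : Bool → List Bool → X) : List Bool → X
  | [] => a
  | x :: η => T x η

theorem joinTree_image {X : Type w} (a : X) (T : Bool → List Bool → X) (n : ℕ) :
    joinTree a T '' {η | η.length < n + 1} =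
      {a} ∪ (T true '' {η | η.length < n} ∪ T false '' {η | η.length < n}) := by
  ext e
  constructor
  · rintro ⟨_ | ⟨_ | _, η⟩, hη, rfl⟩
    · exact Or.inl rfl
    · exact Or.inr (Or.inr ⟨η, Nat.lt_of_succ_lt_succ hη, rfl⟩)
    · exact Or.inr (Or.inl ⟨η, Nat.lt_of_succ_lt_succ hη, rfl⟩)
  · rintro (rfl | ⟨η, hη, rfl⟩ | ⟨η, hη, rfl⟩)
    · exact ⟨[], Nat.succ_pos n, rfl⟩
    · exact ⟨true :: η, Nat.succ_lt_succ hη, rfl⟩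
    · exact ⟨false :: η, Nat.succ_lt_succ hη, rfl⟩

theorem finite_length_lt (n : ℕ) : {η : List Bool | η.length < n}.Finite :=
  List.finite_length_lt Bool n

theorem exists_isMorleyTree [Finite ι] (hm : IsMonster L 𝕄 κ) (hMs : #Ms < κ)
    {U V : Ultrafilter (ι → Ms)} (hU : Universal L c U)
    (hV : (V : Filter (ι → Ms)) ≤ typeFilter L Ms c) (n : ℕ) :
    ∃ T : List Bool → ι → 𝕄, IsMorleyTree (L := L) c U V n T := by
  induction n with
  | zero =>
    have h : {η : List Bool | η.length < 0} = ∅ := by simp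
    refine ⟨fun _ => c, ?_, ?_, fun η hη => absurd hη (Nat.not_lt_zero _),
      fun μ η _ hη => absurd hη (Nat.not_lt_zero _)⟩
    · rw [h, image_empty]
      exact empty_subset _
    · rw [h, image_empty]
      exact ramsey_empty
  | succ n ih =>
    obtain ⟨T, hT⟩ := ih
    set S := T '' {η | η.length < n} with hS
    have hfin : S.Finite := (finite_length_lt n).image T
    have := hfin.to_subtype
    obtain ⟨Q, hQ, hQU⟩ := hU.exists_ultrafilter hT.mem_orbit hfin hT.ramsey
    obtain ⟨D, hD⟩ := exists_generic hm Q (mk_params_lt hm hMs hfin.countable)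
    obtain ⟨ρ, hρ, hρD⟩ := (generic_iff_le_typeFilter.2 hQ).exists_equiv hm hMs
      (hD.mono (subset_params S))
    have hρS : ∀ s : S, Generic L U (params Ms S) (ρ ∘ s.1) := by
      intro s
      have h := hD.comp fun i : ι => (s, i)
      rw [← hρD] at h
      rw [← hQU s]
      exact h
    have hρfin : ((ρ ∘ ·) '' S).Finite := hfin.image _
    obtain ⟨a, ha⟩ := exists_generic hm V
      (mk_params_lt hm hMs (hρfin.union hfin).countable)
    have haorb : a ∈ orbit L Ms c := (generic_iff_le_typeFilter.2 hV).exists_equiv hm hMs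
      (ha.mono (subset_params _))
    let T' : List Bool → ι → 𝕄 := joinTree a fun x η => bif x then ρ ∘ T η else T η
    have himage : T' '' {η | η.length < n + 1} = {a} ∪ ((ρ ∘ ·) '' S ∪ S) := by
      rw [joinTree_image, hS, image_image]
      rfl
    have hJ : range (fun s : S => ρ ∘ s.1) = (ρ ∘ ·) '' S := by
      rw [image_eq_range]
    have hR : Ramsey L Ms c ((ρ ∘ ·) '' S ∪ S) := by
      rw [← hJ]
      refine Ramsey.range_union hm hMs (by rw [hJ]; exact hT.ramsey.image hρ) hT.ramsey Q ?_
      convert hD using 1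
      exact hρD
    refine ⟨T', ?_, ?_, ?_, ?_⟩
    · rw [himage]
      refine union_subset (singleton_subset_iff.2 haorb) (union_subset ?_ hT.mem_orbit)
      rintro _ ⟨s, hs, rfl⟩
      exact comp_mem_orbit hρ (hT.mem_orbit hs)
    · rw [himage, ← range_const (ι := Unit)]
      refine Ramsey.range_union hm hMs (by rw [range_const]; exact ramsey_singleton haorb) hR
        (V.map (· ∘ Prod.snd)) ?_
      exact ha.comp Prod.snd
    · rintro (_ | ⟨x, η⟩) hη
      · refine ha.mono (params_mono ?_)
        rintro _ ⟨_ | ⟨x, e⟩, ⟨-, hne, he⟩, rfl⟩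
        · exact (hne rfl).elim
        · have he' : T e ∈ S := mem_image_of_mem T (Nat.lt_of_succ_lt_succ he)
          cases x
          · exact Or.inr he'
          · exact Or.inl (mem_image_of_mem _ he')
      · have h := hT.path η (Nat.lt_of_succ_lt_succ hη)
        have hsub : {e | x :: η <+: e ∧ e ≠ x :: η ∧ e.length < n + 1} ⊆
            List.cons x '' {e | η <+: e ∧ e ≠ η ∧ e.length < n} := by
          rintro _ ⟨⟨t, rfl⟩, hne, he⟩
          exact ⟨η ++ t, ⟨⟨t, rfl⟩, fun h => hne (congrArg _ h), Nat.lt_of_succ_lt_succ he⟩, rfl⟩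
        have hsub' := image_mono (f := T') hsub
        rw [image_image] at hsub'
        cases x
        · exact h.mono (params_mono hsub')
        · have h' := h.image hρ
          rw [hρ.image_params, image_image] at h'
          exact h'.mono (params_mono hsub')
    · rintro (_ | ⟨x, μ⟩) (_ | ⟨y, η⟩) hμ hη
      · exact absurd hμ (by simp)
      · obtain ⟨t, ht⟩ := hμ
        obtain ⟨rfl, rfl⟩ := List.cons.inj ht
        refine (hρS ⟨T t, mem_image_of_mem T (Nat.lt_of_succ_lt_succ hη)⟩).mono (params_mono ?_)
        rintro _ ⟨_, ⟨⟨e, rfl⟩, he⟩, rfl⟩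
        exact mem_image_of_mem T (Nat.lt_of_succ_lt_succ he)
      · exact absurd hμ (by simp)
      · obtain ⟨t, ht⟩ := hμ
        obtain ⟨rfl, ht'⟩ := List.cons.inj ht
        have h := hT.comb μ η ⟨t, ht'⟩ (Nat.lt_of_succ_lt_succ hη)
        have hsub : {e | x :: μ ++ [false] <+: e ∧ e.length < n + 1} ⊆
            List.cons x '' {e | μ ++ [false] <+: e ∧ e.length < n} := by
          rintro _ ⟨⟨t, rfl⟩, he⟩
          exact ⟨μ ++ [false] ++ t, ⟨⟨t, rfl⟩, Nat.lt_of_succ_lt_succ he⟩, rfl⟩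
        have hsub' := image_mono (f := T') hsub
        rw [image_image] at hsub'
        cases x
        · exact h.mono (params_mono hsub')
        · have h' := h.image hρ
          rw [hρ.image_params, image_image] at h'
          exact h'.mono (params_mono hsub')

/-- A descending comb in a Morley tree is a Morley sequence in `U`. -/
theorem IsMorleyTree.morleySeg_comb {U V : Ultrafilter (ι → Ms)} {n : ℕ}
    (hU : (U : Filter (ι → Ms)) ≤ typeFilter L Ms c)
    {T : List Bool → ι → 𝕄} (hT : IsMorleyTree (L := L) c U V n T) {l : ℕ} {η : Fin l → List Bool}
    (hη : DescendingComb η) (hlen : ∀ i, (η i).length < n) :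
    MorleySeg L U l fun i => if h : i < l then T (η ⟨i, h⟩) else c := by
  rintro (_ | i) hi
  · rw [show Iio 0 = (∅ : Set ℕ) by simp, image_empty, params_empty, generic_iff_le_typeFilter]
    simp only [dif_pos hi]
    obtain ⟨σ, hσ, h⟩ := hT.mem_orbit (mem_image_of_mem T (hlen ⟨0, hi⟩))
    rwa [← h, typeFilter_image hσ]
  · obtain ⟨μ, hμ, h⟩ := hη.exists_branching hi
    simp only [dif_pos hi]
    refine (hT.comb μ _ hμ (hlen _)).mono (params_mono ?_)
    rintro _ ⟨j, hj, rfl⟩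
    have hjl : j < l := (mem_Iio.1 hj).trans hi
    simp only [dif_pos hjl]
    exact mem_image_of_mem T ⟨h _ hj, hlen _⟩

/-- A path in a Morley tree, read downwards, is a Morley sequence in `V`. -/
theorem IsMorleyTree.morleySeg_path {U V : Ultrafilter (ι → Ms)} {n : ℕ}
    {T : List Bool → ι → 𝕄} (hT : IsMorleyTree (L := L) c U V n T) (σ : ℕ → Bool) {l : ℕ}
    {e : ℕ → ℕ} (he : StrictAntiOn e (Iio l)) (hlen : ∀ i < l, e i < n) :
    MorleySeg L V l fun i => T (List.ofFn fun j : Fin (e i) => σ j) := by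
  intro i hi
  refine (hT.path _ (by simpa using hlen i hi)).mono (params_mono ?_)
  rintro _ ⟨j, hj, rfl⟩
  have hjl : j < l := (mem_Iio.1 hj).trans hi
  have hlt : e i < e j := he hjl hi hj
  refine mem_image_of_mem T ⟨?_, fun h => ?_, by simpa using hlen j hjl⟩
  · rw [List.prefix_iff_eq_take]
    apply List.ext_getElem
    · simp [hlt.le]
    · intros
      simp
  · have := congrArg List.length h
    simp only [List.length_ofFn] at this
    omega

end Tree

section Forking

variable {L : FirstOrder.Language.{u, u}} {𝕄 : Type u} [L.Structure 𝕄] {κ : Cardinal.{u}}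
  {Ms : Set 𝕄}

theorem KimDivides.kimForks {α : Type v} {n : ℕ} {φ : L.Formula (α ⊕ Fin n)} {b : Fin n → 𝕄}
    (h : KimDivides L Ms φ b) : KimForks L Ms φ b :=
  ⟨1, fun _ => n, fun _ => φ, fun _ => b, fun _ => h, fun _ ha => ⟨0, ha⟩⟩

theorem IsMonster.exists_realize_of_forall_lt (hm : IsMonster L 𝕄 κ) {α : Type v} [Countable α]
    {n : ℕ} (φ : L.Formula (α ⊕ Fin n)) (B : ℕ → Fin n → 𝕄)
    (h : ∀ k : ℕ, ∃ a : α → 𝕄, ∀ i < k, φ.Realize (Sum.elim a (B i))) :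
    ∃ a : α → 𝕄, ∀ i, φ.Realize (Sum.elim a (B i)) := by
  let D : ℕ → Set (α → 𝕄) := fun i => {a | φ.Realize (Sum.elim a (B i))}
  obtain ⟨a, ha⟩ := hm.exists_mem_sInter (A := ⋃ i, range (B i))
    ((countable_iUnion fun i => countable_range (B i)).le_aleph0.trans_lt hm.1) (range D) (by
      rintro _ ⟨i, rfl⟩
      exact definable_setOf_realize φ fun j => mem_iUnion_of_mem i (mem_range_self j)) (by
      intro t ht hfin
      choose a ha using h
      obtain ⟨k, hk⟩ := ((eventually_all_finite hfin).2 fun E hE => by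
        obtain ⟨i, rfl⟩ := ht hE
        exact (eventually_gt_atTop i).mono fun k hk => ha k i hk).exists (f := atTop)
          (p := fun k => ∀ E ∈ t, a k ∈ E)
      exact ⟨a k, hk⟩)
  exact ⟨a, fun i => ha _ (mem_range_self i)⟩

theorem definable_exists_forall_realize {α β : Type*} [Finite β] {ι J : Type*} [Finite J]
    (ψ : L.Formula (β ⊕ ι)) (g : J → ι → α) (A : Set 𝕄) :
    A.Definable L {v : α → 𝕄 | ∃ a : β → 𝕄, ∀ i, ψ.Realize (Sum.elim a (v ∘ g i))} := by
  refine Definable.mono (empty_definable_iff.2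
    ⟨(Formula.iInf fun i => ψ.relabel (Sum.elim Sum.inr (Sum.inl ∘ g i))).iExs β, ?_⟩)
    (empty_subset A)
  ext v
  simp only [mem_ofPred_eq, Formula.realize_iExs, Formula.realize_iInf, Formula.realize_relabel]
  refine exists_congr fun a => forall_congr' fun i => iff_of_eq (congrArg _ ?_)
  funext x
  rcases x with x | x <;> rfl

/-- By compactness, it suffices to find the pattern witnessing `k`-`DCTP₂` in trees of arbitrarily
large finite height. -/
theorem IsMonster.hasKDCTP2 (hm : IsMonster L 𝕄 κ) {r m k : ℕ} (ψ : L.Formula (Fin r ⊕ Fin m))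
    (h : ∀ n : ℕ, ∃ T : List Bool → Fin m → 𝕄,
      (∀ (σ : ℕ → Bool) (s : Finset ℕ), s.card = k → (∀ i ∈ s, i < n) →
        ¬ ∃ a : Fin r → 𝕄, ∀ i ∈ s, ψ.Realize (Sum.elim a (T (List.ofFn fun j : Fin i => σ j)))) ∧
      ∀ (l : ℕ) (η : Fin l → List Bool), DescendingComb η → (∀ i, (η i).length < n) →
        ∃ a : Fin r → 𝕄, ∀ i, ψ.Realize (Sum.elim a (T (η i)))) :
    HasKDCTP2 L 𝕄 k := by
  let P : (ℕ → Bool) × {s : Finset ℕ // s.card = k} → Set (List Bool × Fin m → 𝕄) := fun p =>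
    {v | ∃ a : Fin r → 𝕄, ∀ i : p.2.1, ψ.Realize
      (Sum.elim a (v ∘ Prod.mk (List.ofFn fun j : Fin i => p.1 j)))}ᶜ
  let C : (Σ l : ℕ, {η : Fin l → List Bool // DescendingComb η}) →
      Set (List Bool × Fin m → 𝕄) := fun p =>
    {v | ∃ a : Fin r → 𝕄, ∀ i, ψ.Realize (Sum.elim a (v ∘ Prod.mk (p.2.1 i)))}
  choose T hT using h
  let W : ℕ → List Bool × Fin m → 𝕄 := fun n p => T n p.1 p.2
  have hev : ∀ D ∈ range P ∪ range C, ∀ᶠ n in atTop, W n ∈ D := by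
    rintro _ (⟨⟨σ, s, hs⟩, rfl⟩ | ⟨⟨l, η, hη⟩, rfl⟩)
    · filter_upwards [eventually_gt_atTop (s.sup id)] with n hn
      rintro ⟨a, ha⟩
      exact (hT n).1 σ s hs (fun i hi => (s.le_sup (f := id) hi).trans_lt hn)
        ⟨a, fun i hi => ha ⟨i, hi⟩⟩
    · filter_upwards [eventually_all.2 fun i => eventually_gt_atTop (η i).length] with n hn
      exact (hT n).2 l η hη hn
  obtain ⟨v, hv⟩ := hm.exists_mem_sInter (A := ∅) (by simpa using aleph0_pos.trans hm.1)
    (range P ∪ range C) (by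
      rintro _ (⟨p, rfl⟩ | ⟨p, rfl⟩)
      · exact (definable_exists_forall_realize ψ _ ∅).compl
      · exact definable_exists_forall_realize ψ _ ∅)
    (fun t ht hfin => by
      obtain ⟨n, hn⟩ := ((eventually_all_finite hfin).2 fun D hD => hev D (ht hD)).exists
      exact ⟨W n, hn⟩)
  refine ⟨r, m, ψ, fun η i => v (η, i), fun σ s hs => ?_, fun l η hη => ?_⟩
  · rintro ⟨a, ha⟩
    exact hv _ (Or.inl ⟨(σ, ⟨s, hs⟩), rfl⟩) ⟨a, fun i => ha i i.2⟩
  · exact hv _ (Or.inr ⟨⟨l, η, hη⟩, rfl⟩)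

/-- If `φ` implies a finite disjunction and does not Kim-divide, then one of the disjuncts is
consistent along every Morley sequence in a given coheir. -/
theorem exists_forall_morleySeg_realize {ι : Type} [Countable ι] (hm : IsMonster L 𝕄 κ)
    (hMs : #Ms < κ) {c : ι → 𝕄} {U : Ultrafilter (ι → Ms)}
    (hU : (U : Filter (ι → Ms)) ≤ typeFilter L Ms c) {α : Type v} {m : ℕ}
    {φ : L.Formula (α ⊕ Fin m)} (f : Fin m → ι) (hφ : ¬ KimDivides L Ms φ (c ∘ f))
    {J : Type w} [Finite J] {n : J → ℕ} {ψ : ∀ j, L.Formula (α ⊕ Fin (n j))}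
    (g : ∀ j, Fin (n j) → ι)
    (h : ∀ a : α → 𝕄, φ.Realize (Sum.elim a (c ∘ f)) →
      ∃ j, (ψ j).Realize (Sum.elim a (c ∘ g j))) :
    ∃ j, ∀ (l : ℕ) (d : ℕ → ι → 𝕄), MorleySeg L U l d →
      ∃ a : α → 𝕄, ∀ i < l, (ψ j).Realize (Sum.elim a (d i ∘ g j)) := by
  obtain ⟨d, rfl, hd⟩ := exists_morleySeg hm hMs hU
  obtain ⟨a, ha⟩ : ∃ a : α → 𝕄, ∀ i, φ.Realize (Sum.elim a (d i ∘ f)) := by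
    by_contra hn
    exact hφ ⟨fun i => d i ∘ f, MorleySeg.coheirMorley fun l => (hd l).comp f, rfl, hn⟩
  have hj : ∀ i, ∃ j, (ψ j).Realize (Sum.elim a (d i ∘ g j)) := by
    intro i
    obtain ⟨σ, -, hσ⟩ := (generic_iff_le_typeFilter.2 hU).exists_equiv hm hMs
      ((hd (i + 1) i i.lt_succ_self).mono (subset_params _))
    have hφi := (StrongHomClass.realize_formula σ.symm φ).2 (ha i)
    rw [Sum.comp_elim] at hφi
    have hsymm : ∀ {X : Type} (e : X → ι), σ.symm ∘ d i ∘ e = d 0 ∘ e := fun e => by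
      funext x
      rw [← hσ]
      exact σ.symm_apply_apply _
    rw [hsymm f] at hφi
    obtain ⟨j, hj⟩ := h _ hφi
    refine ⟨j, (StrongHomClass.realize_formula σ.symm (ψ j)).1 ?_⟩
    rwa [Sum.comp_elim, hsymm]
  choose J' hJ' using hj
  obtain ⟨j, hj⟩ := Finite.exists_infinite_fiber J'
  refine ⟨j, fun l d' hd' => ?_⟩
  classical
  let e := Nat.orderEmbeddingOfSet (J' ⁻¹' {j})
  refine MorleySeg.realize_of_realize hm hMs
    ((MorleySeg.strictMono hd e.strictMono l).comp (g j)) (hd'.comp (g j))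
    ⟨a, fun i _ => ?_⟩
  have hi : J' (e i) = j := by
    rw [Nat.orderEmbeddingOfSet_apply]
    exact (Nat.Subtype.ofNat (J' ⁻¹' {j}) i).2
  exact hi ▸ hJ' (e i)

theorem IsMorleyTree.not_exists_realize_path {ι : Type} {c : ι → 𝕄} {U V : Ultrafilter (ι → Ms)}
    {n : ℕ} {T : List Bool → ι → 𝕄} (hT : IsMorleyTree (L := L) c U V n T) {α : Type v}
    {ψ : L.Formula (α ⊕ ι)} {k : ℕ}
    (hψ : ∀ d : ℕ → ι → 𝕄, MorleySeg L V k d →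
      ¬ ∃ a : α → 𝕄, ∀ i < k, ψ.Realize (Sum.elim a (d i)))
    (σ : ℕ → Bool) {s : Finset ℕ} (hs : s.card = k) (hlt : ∀ i ∈ s, i < n) :
    ¬ ∃ a : α → 𝕄, ∀ i ∈ s, ψ.Realize (Sum.elim a (T (List.ofFn fun j : Fin i => σ j))) := by
  rintro ⟨a, ha⟩
  let e : ℕ → ℕ := fun i => if h : i < k then s.orderEmbOfFin hs (Fin.rev ⟨i, h⟩) else 0
  have he : ∀ i < k, e i ∈ s := fun i hi => by
    simp only [e, dif_pos hi]
    exact s.orderEmbOfFin_mem hs _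
  have hanti : StrictAntiOn e (Iio k) := by
    intro i hi j hj hij
    simp only [e, dif_pos (mem_Iio.1 hi), dif_pos (mem_Iio.1 hj)]
    exact (s.orderEmbOfFin hs).strictMono (Fin.rev_lt_rev.2 hij)
  exact hψ _ (hT.morleySeg_path σ hanti fun i hi => hlt _ (he i hi))
    ⟨a, fun i hi => ha _ (he i hi)⟩

theorem IsMorleyTree.exists_realize_comb {ι : Type} {c : ι → 𝕄} {U V : Ultrafilter (ι → Ms)}
    (hU : (U : Filter (ι → Ms)) ≤ typeFilter L Ms c)
    {n : ℕ} {T : List Bool → ι → 𝕄} (hT : IsMorleyTree (L := L) c U V n T) {α : Type v}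
    {ψ : L.Formula (α ⊕ ι)}
    (hψ : ∀ (l : ℕ) (d : ℕ → ι → 𝕄), MorleySeg L U l d →
      ∃ a : α → 𝕄, ∀ i < l, ψ.Realize (Sum.elim a (d i)))
    {l : ℕ} {η : Fin l → List Bool} (hη : DescendingComb η) (hlen : ∀ i, (η i).length < n) :
    ∃ a : α → 𝕄, ∀ i, ψ.Realize (Sum.elim a (T (η i))) := by
  obtain ⟨a, ha⟩ := hψ l _ (hT.morleySeg_comb hU hη hlen)
  refine ⟨a, fun i => ?_⟩
  have := ha i i.2
  rwa [dif_pos i.2] at this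

/-- If Kim-forking differs from Kim-dividing over `Ms`, then some `k`-`DCTP₂` pattern exists. -/
theorem KimForks.exists_hasKDCTP2 (hm : IsMonster L 𝕄 κ) (hMs : IsElemSubmodel L Ms)
    (hcard : #Ms < κ) {r m : ℕ} {φ : L.Formula (Fin r ⊕ Fin m)} {b : Fin m → 𝕄}
    (hf : KimForks L Ms φ b) (hd : ¬ KimDivides L Ms φ b) : ∃ k, 2 ≤ k ∧ HasKDCTP2 L 𝕄 k := by
  obtain ⟨N, n, ψ, e, hψ, himp⟩ := hf
  let c : Fin m ⊕ (Σ j : Fin N, Fin (n j)) → 𝕄 := Sum.elim b fun p => e p.1 p.2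
  obtain ⟨U, hU⟩ := exists_universal hMs c
  obtain ⟨j, hj⟩ := exists_forall_morleySeg_realize hm hcard hU.le_typeFilter Sum.inl hd
    (fun j i => Sum.inr ⟨j, i⟩) himp
  let f : Fin (n j) → Fin m ⊕ (Σ j : Fin N, Fin (n j)) := fun i => Sum.inr ⟨j, i⟩
  obtain ⟨B, ⟨q, hB⟩, hB0, hincons⟩ := hψ j
  obtain ⟨V, hV, hVB⟩ := exists_ultrafilter_of_morleyIn hMs (c := c) f hB hB0
  obtain ⟨k, hk⟩ : ∃ k, ¬ ∃ a : Fin r → 𝕄, ∀ i < k, (ψ j).Realize (Sum.elim a (B i)) := by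
    by_contra! h
    exact hincons (hm.exists_realize_of_forall_lt (ψ j) B h)
  let ψ' : L.Formula (Fin r ⊕ (Fin m ⊕ (Σ j : Fin N, Fin (n j)))) :=
    (ψ j).relabel (Sum.map id f)
  have hψ' : ∀ (a : Fin r → 𝕄) (d : Fin m ⊕ (Σ j : Fin N, Fin (n j)) → 𝕄),
      ψ'.Realize (Sum.elim a d) ↔ (ψ j).Realize (Sum.elim a (d ∘ f)) := fun a d => by
    rw [Formula.realize_relabel, Sum.elim_comp_map, Function.comp_id]
  refine ⟨k + 2, Nat.le_add_left 2 k, hm.hasKDCTP2 (ψ j) fun M => ?_⟩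
  obtain ⟨T, hT⟩ := exists_isMorleyTree hm hcard hU hV M
  refine ⟨fun η => T η ∘ f, fun σ s hs hlt => ?_, fun l η hη hlen => ?_⟩
  · simp_rw [← hψ']
    refine hT.not_exists_realize_path (fun d hd => ?_) σ hs hlt
    simp_rw [hψ']
    intro h
    obtain ⟨a, ha⟩ := (hd.comp f).realize_of_realize hm hcard (hVB _) h
    exact hk ⟨a, fun i hi => ha i (hi.trans_le (Nat.le_add_right k 2))⟩
  · simp_rw [← hψ']
    refine hT.exists_realize_comb hU.le_typeFilter (fun l d hd => ?_) hη hlen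
    simp_rw [hψ']
    exact hj l d hd

end Forking

end NSOP2Paper

namespace NSOP2Paper

/-- **Corollary 4.11.** Let `T` be a complete theory without `k`-`DCTP₂` for
all `k ≥ 2`.  Then for formulas, Kim-forking over `M` coincides with
Kim-dividing over `M` (with respect to coheir Morley sequences). -/
theorem natp_kim_forking_eq_dividing (L : FirstOrder.Language.{u, u}) (𝕄 : Type u)
    [L.Structure 𝕄] (κ : Cardinal.{u}) (hmonster : IsMonster L 𝕄 κ)
    (hnodctp2 : ∀ k : ℕ, 2 ≤ k → ¬ HasKDCTP2 L 𝕄 k)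
    (Ms : Set 𝕄) (hMs : IsElemSubmodel L Ms) (hMssmall : Cardinal.mk Ms < κ) :
    ∀ (r m : ℕ) (φ : L.Formula (Fin r ⊕ Fin m)) (b : Fin m → 𝕄),
      KimForks L Ms φ b ↔ KimDivides L Ms φ b := by
  intro r m φ b
  refine ⟨fun hf => ?_, KimDivides.kimForks⟩
  by_contra hd
  obtain ⟨k, hk, hkd⟩ := hf.exists_hasKDCTP2 hmonster hMs hMssmall hd
  exact hnodctp2 k hk hkd

end NSOP2Paper
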